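/- The category ⟨∘•∘•⟩ generated by the four-block ∘•∘• consists exactly of the noncrossing two-colored partitions such that, when rotated to a partition with no upper points, every block has even length and its points are colored white and black alternatingly. -/

import Mathlib

noncomputable section
namespace CTCP

/-- Colors of points: `true` = white (∘), `false` = black (•). -/
abbrev Color := Bool

def white : Color := true
def black : Color := false

/-- A two-colored partition with `k` upper and `l` lower points.  The block
structure is recorded as a setoid on the disjoint union of the points. -/
structure TCP where
  k : ℕ
  l : ℕ
  upColor : Fin k → Color
  lowColor : Fin l → Color
  rel : Setoid (Fin k ⊕ Fin l)

/-- The disjoint union of two equivalence relations. -/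
def sumRel {α β : Type*} (r : Setoid α) (s : Setoid β) : (α ⊕ β) → (α ⊕ β) → Prop
  | .inl a, .inl b => r.r a b
  | .inr a, .inr b => s.r a b
  | _, _ => False

def sumSetoid {α β : Type*} (r : Setoid α) (s : Setoid β) : Setoid (α ⊕ β) where
  r := sumRel r s
  iseqv := by
    constructor
    · rintro (a | a)
      · exact r.iseqv.refl a
      · exact s.iseqv.refl a
    · rintro (a | a) (b | b) h
      · exact r.iseqv.symm h
      · exact h.elim
      · exact h.elim
      · exact s.iseqv.symm h
    · rintro (a | a) (b | b) (c | c) h₁ h₂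
      all_goals first
        | exact r.iseqv.trans h₁ h₂
        | exact s.iseqv.trans h₁ h₂
        | exact h₁.elim
        | exact h₂.elim

def splitPt (p q : TCP) :
    (Fin (p.k + q.k) ⊕ Fin (p.l + q.l)) → ((Fin p.k ⊕ Fin p.l) ⊕ (Fin q.k ⊕ Fin q.l))
  | .inl i => (finSumFinEquiv.symm i).elim (fun a => .inl (.inl a)) (fun b => .inr (.inl b))
  | .inr j => (finSumFinEquiv.symm j).elim (fun a => .inl (.inr a)) (fun b => .inr (.inr b))

/-- Tensor product (horizontal concatenation) of two-colored partitions. -/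
def tensor (p q : TCP) : TCP where
  k := p.k + q.k
  l := p.l + q.l
  upColor := fun i => (finSumFinEquiv.symm i).elim p.upColor q.upColor
  lowColor := fun j => (finSumFinEquiv.symm j).elim p.lowColor q.lowColor
  rel := Setoid.comap (splitPt p q) (sumSetoid p.rel q.rel)

def compEmbMid (q p : TCP) (h : q.l = p.k) :
    (Fin p.k ⊕ Fin p.l) → ((Fin q.k ⊕ Fin q.l) ⊕ Fin p.l)
  | .inl i => .inl (.inr (Fin.cast h.symm i))
  | .inr j => .inr j

/-- The relation generating the blocks of the composition of `q` and `p`: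
the blocks of `q` together with the blocks of `p`, glued along the middle row. -/
def compRel (q p : TCP) (h : q.l = p.k) :
    ((Fin q.k ⊕ Fin q.l) ⊕ Fin p.l) → ((Fin q.k ⊕ Fin q.l) ⊕ Fin p.l) → Prop :=
  fun t t' =>
    (∃ x y, q.rel.r x y ∧ t = .inl x ∧ t' = .inl y) ∨
    (∃ x y, p.rel.r x y ∧ t = compEmbMid q p h x ∧ t' = compEmbMid q p h y)

/-- Composition (vertical concatenation) of `q ∈ P(k,l)` with `p ∈ P(l,m)`:
blocks are joined through the middle points, which are then deleted. -/
def comp (q p : TCP) (h : q.l = p.k) : TCP where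
  k := q.k
  l := p.l
  upColor := q.upColor
  lowColor := p.lowColor
  rel := Setoid.comap
    (Sum.elim (fun i : Fin q.k => (Sum.inl (Sum.inl i) : (Fin q.k ⊕ Fin q.l) ⊕ Fin p.l))
      (fun j : Fin p.l => Sum.inr j))
    (Relation.EqvGen.setoid (compRel q p h))

/-- The colors of the lower row of `q` match the colors of the upper row of `p`. -/
def ColorsMatch (q p : TCP) (h : q.l = p.k) : Prop :=
  ∀ j : Fin q.l, q.lowColor j = p.upColor (Fin.cast h j)

/-- Involution: reflection at the horizontal axis. -/
def invol (p : TCP) : TCP where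
  k := p.l
  l := p.k
  upColor := p.lowColor
  lowColor := p.upColor
  rel := Setoid.comap Sum.swap p.rel

/-- Vertical reflection: reflection at the vertical axis. -/
def vref (p : TCP) : TCP where
  k := p.k
  l := p.l
  upColor := fun i => p.upColor i.rev
  lowColor := fun j => p.lowColor j.rev
  rel := Setoid.comap (Sum.map Fin.rev Fin.rev) p.rel

/-- Inversion of colors. -/
def cinv (p : TCP) : TCP where
  k := p.k
  l := p.l
  upColor := fun i => !(p.upColor i)
  lowColor := fun j => !(p.lowColor j)
  rel := p.rel

/-- Verticolor reflection `p̃`: vertical reflection combined with color inversion. -/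
def vcref (p : TCP) : TCP := cinv (vref p)

/-- Rotation of the leftmost upper point to the left end of the lower row
(inverting its color). -/
def rotULdown (p : TCP) (h : 0 < p.k) : TCP where
  k := p.k - 1
  l := p.l + 1
  upColor := fun i => p.upColor ⟨i.1 + 1, by have := i.2; omega⟩
  lowColor := fun j =>
    if hj : j.1 = 0 then !(p.upColor ⟨0, h⟩)
    else p.lowColor ⟨j.1 - 1, by have := j.2; omega⟩
  rel := Setoid.comap
    (Sum.elim
      (fun i : Fin (p.k - 1) => (Sum.inl ⟨i.1 + 1, by have := i.2; omega⟩ : Fin p.k ⊕ Fin p.l))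
      (fun j : Fin (p.l + 1) =>
        if hj : j.1 = 0 then Sum.inl ⟨0, h⟩
        else Sum.inr ⟨j.1 - 1, by have := j.2; omega⟩))
    p.rel

/-- Rotation of the rightmost upper point to the right end of the lower row
(inverting its color). -/
def rotURdown (p : TCP) (h : 0 < p.k) : TCP where
  k := p.k - 1
  l := p.l + 1
  upColor := fun i => p.upColor ⟨i.1, by have := i.2; omega⟩
  lowColor := fun j =>
    if hj : j.1 < p.l then p.lowColor ⟨j.1, hj⟩
    else !(p.upColor ⟨p.k - 1, by omega⟩)
  rel := Setoid.comap
    (Sum.elim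
      (fun i : Fin (p.k - 1) => (Sum.inl ⟨i.1, by have := i.2; omega⟩ : Fin p.k ⊕ Fin p.l))
      (fun j : Fin (p.l + 1) =>
        if hj : j.1 < p.l then Sum.inr ⟨j.1, hj⟩
        else Sum.inl ⟨p.k - 1, by omega⟩))
    p.rel

/-- Rotation of the leftmost lower point to the left end of the upper row
(inverting its color). -/
def rotULup (p : TCP) (h : 0 < p.l) : TCP where
  k := p.k + 1
  l := p.l - 1
  upColor := fun i =>
    if hi : i.1 = 0 then !(p.lowColor ⟨0, h⟩)
    else p.upColor ⟨i.1 - 1, by have := i.2; omega⟩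
  lowColor := fun j => p.lowColor ⟨j.1 + 1, by have := j.2; omega⟩
  rel := Setoid.comap
    (Sum.elim
      (fun i : Fin (p.k + 1) =>
        if hi : i.1 = 0 then (Sum.inr ⟨0, h⟩ : Fin p.k ⊕ Fin p.l)
        else Sum.inl ⟨i.1 - 1, by have := i.2; omega⟩)
      (fun j : Fin (p.l - 1) => Sum.inr ⟨j.1 + 1, by have := j.2; omega⟩))
    p.rel

/-- Rotation of the rightmost lower point to the right end of the upper row
(inverting its color). -/
def rotURup (p : TCP) (h : 0 < p.l) : TCP where
  k := p.k + 1
  l := p.l - 1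
  upColor := fun i =>
    if hi : i.1 < p.k then p.upColor ⟨i.1, hi⟩
    else !(p.lowColor ⟨p.l - 1, by omega⟩)
  lowColor := fun j => p.lowColor ⟨j.1, by have := j.2; omega⟩
  rel := Setoid.comap
    (Sum.elim
      (fun i : Fin (p.k + 1) =>
        if hi : i.1 < p.k then (Sum.inl ⟨i.1, hi⟩ : Fin p.k ⊕ Fin p.l)
        else Sum.inr ⟨p.l - 1, by omega⟩)
      (fun j : Fin (p.l - 1) => Sum.inr ⟨j.1, by have := j.2; omega⟩))
    p.rel

/-- `p'` is obtained from `p` by rotating an outermost point of one row to the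
corresponding end of the other row, inverting its color. -/
def IsRotationOf (p' p : TCP) : Prop :=
  (∃ h : 0 < p.k, p' = rotULdown p h) ∨ (∃ h : 0 < p.k, p' = rotURdown p h) ∨
  (∃ h : 0 < p.l, p' = rotULup p h) ∨ (∃ h : 0 < p.l, p' = rotURup p h)

/-- A partition with no upper points, given by colors and block labels. -/
def mkLower (n : ℕ) (color : Fin n → Color) (lbl : Fin n → ℕ) : TCP where
  k := 0
  l := n
  upColor := Fin.elim0
  lowColor := color
  rel := Setoid.ker (Sum.elim Fin.elim0 lbl)

/-- The identity partition of color `c`. -/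
def idPart (c : Color) : TCP where
  k := 1
  l := 1
  upColor := fun _ => c
  lowColor := fun _ => c
  rel := ⊤

/-- The pair partition on two lower points of colors `c₁`, `c₂`. -/
def pairLower (c₁ c₂ : Color) : TCP := mkLower 2 ![c₁, c₂] (fun _ => 0)

/-- The singleton of color `c`. -/
def singl (c : Color) : TCP := mkLower 1 (fun _ => c) (fun _ => 0)

/-- `bPart s` : one block on `s` white lower points (`bPart 0` is the empty partition). -/
def bPart (s : ℕ) : TCP := mkLower s (fun _ => white) (fun _ => 0)

/-- One block on four lower points with the given colors. -/
def fourBlock (c₁ c₂ c₃ c₄ : Color) : TCP := mkLower 4 ![c₁, c₂, c₃, c₄] (fun _ => 0)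

/-- The four-block ∘•∘•. -/
def fourWBWB : TCP := fourBlock white black white black

/-- The four-block ∘∘••. -/
def fourWWBB : TCP := fourBlock white white black black

/-- The empty partition. -/
def emptyPart : TCP := mkLower 0 Fin.elim0 Fin.elim0

/-- The partition ∘⊗• (a white and a black singleton). -/
def singPair : TCP := tensor (singl white) (singl black)

/-- The partition ∘∘⊗••. -/
def wwbb : TCP := tensor (pairLower white white) (pairLower black black)

/-- The crossing partition `X` on four white points: first upper point connected to the
second lower point, second upper point connected to the first lower point. -/
def crossPart : TCP where
  k := 2
  l := 2
  upColor := fun _ => white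
  lowColor := fun _ => white
  rel := Setoid.ker (Sum.elim (fun i : Fin 2 => (i.1 : ℕ)) (fun j : Fin 2 => 1 - j.1))

/-- `n`-fold tensor power. -/
def tensorPow (p : TCP) : ℕ → TCP
  | 0 => emptyPart
  | n + 1 => tensor (tensorPow p n) p

/-- The partition `p_d`: from left to right, `d` white singletons, a white point, `d` black
singletons and a black point, the two non-singleton points forming a pair block. -/
def pPart (d : ℕ) : TCP :=
  mkLower (2 * d + 2) (fun j => decide (j.1 ≤ d))
    (fun j => if j.1 = d ∨ j.1 = 2 * d + 1 then 0 else j.1 + 1)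

/-- The partition `p′_r`: from left to right, `r+1` white singletons, a black point, `r−1`
black singletons and a black point, the black non-singleton points forming a pair block;
for `r = 0` the middle consists of one white singleton instead. -/
def pPrime (r : ℕ) : TCP :=
  if r = 0 then
    mkLower 4 ![white, black, white, black]
      (fun j => if j.1 = 1 ∨ j.1 = 3 then 0 else j.1 + 1)
  else
    mkLower (2 * r + 2) (fun j => decide (j.1 ≤ r))
      (fun j => if j.1 = r + 1 ∨ j.1 = 2 * r + 1 then 0 else j.1 + 1)

/-- A category of two-colored partitions: a class of two-colored partitions closed under
tensor products, composition (when defined) and involution, containing both bicolored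
pair partitions and both identity partitions. -/
structure IsCategory (C : Set TCP) : Prop where
  tensor_mem : ∀ p ∈ C, ∀ q ∈ C, tensor p q ∈ C
  comp_mem : ∀ q ∈ C, ∀ p ∈ C, ∀ h : q.l = p.k, ColorsMatch q p h → comp q p h ∈ C
  invol_mem : ∀ p ∈ C, invol p ∈ C
  idw_mem : idPart white ∈ C
  idb_mem : idPart black ∈ C
  pairwb_mem : pairLower white black ∈ C
  pairbw_mem : pairLower black white ∈ C

/-- The smallest category of partitions containing `S`. -/
def generated (S : Set TCP) : Set TCP :=
  {p | ∀ C : Set TCP, IsCategory C → S ⊆ C → p ∈ C}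

/-- `c(p)` : (white lower points + black upper points) − (black lower points + white upper
points). -/
def cval (p : TCP) : ℤ :=
  ((Nat.card {j : Fin p.l // p.lowColor j = white} +
      Nat.card {i : Fin p.k // p.upColor i = black} : ℕ) : ℤ) -
    ((Nat.card {j : Fin p.l // p.lowColor j = black} +
      Nat.card {i : Fin p.k // p.upColor i = white} : ℕ) : ℤ)

/-- Position of a point on the line obtained by rotating all upper points down to the
left of the lower row. -/
def linePos (p : TCP) : (Fin p.k ⊕ Fin p.l) → ℕ :=
  Sum.elim (fun i => p.k - 1 - i.1) (fun j => p.k + j.1)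

/-- A partition is noncrossing if its strings can be drawn without crossings. -/
def Noncrossing (p : TCP) : Prop :=
  ∀ a b x y : Fin p.k ⊕ Fin p.l,
    linePos p a < linePos p b → linePos p b < linePos p x → linePos p x < linePos p y →
    p.rel.r a x → p.rel.r b y → p.rel.r a b

/-- The number of points in the block of the point `x`. -/
def blockSize (p : TCP) (x : Fin p.k ⊕ Fin p.l) : ℕ := Nat.card {y // p.rel.r x y}

/-- The partition obtained from `p` by rotating all upper points down, so that it has no
upper points. -/
def toLine (p : TCP) : TCP where
  k := 0
  l := p.k + p.l
  upColor := Fin.elim0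
  lowColor := fun j =>
    if hj : j.1 < p.k then !(p.upColor ⟨p.k - 1 - j.1, by omega⟩)
    else p.lowColor ⟨j.1 - p.k, by have := j.2; omega⟩
  rel := Setoid.comap
    (Sum.elim (fun i : Fin 0 => (Fin.elim0 i : Fin p.k ⊕ Fin p.l))
      (fun j : Fin (p.k + p.l) =>
        if hj : j.1 < p.k then Sum.inl ⟨p.k - 1 - j.1, by omega⟩
        else Sum.inr ⟨j.1 - p.k, by have := j.2; omega⟩))
    p.rel

def eraseLowRel (p : TCP) (j : ℕ) (hj : j + 1 < p.l) :
    (Fin p.k ⊕ Fin p.l) → (Fin p.k ⊕ Fin p.l) → Prop :=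
  fun x y => p.rel.r x y ∨ (x = Sum.inr ⟨j, by omega⟩ ∧ y = Sum.inr ⟨j + 1, hj⟩)

/-- Erasing the `j`-th and `(j+1)`-th lower points of `p`, first joining their blocks. -/
def eraseLowerPair (p : TCP) (j : ℕ) (hj : j + 1 < p.l) : TCP where
  k := p.k
  l := p.l - 2
  upColor := p.upColor
  lowColor := fun m =>
    if hm : m.1 < j then p.lowColor ⟨m.1, by omega⟩
    else p.lowColor ⟨m.1 + 2, by have := m.2; omega⟩
  rel := Setoid.comap
    (Sum.elim (fun i : Fin p.k => (Sum.inl i : Fin p.k ⊕ Fin p.l))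
      (fun m : Fin (p.l - 2) =>
        if hm : m.1 < j then Sum.inr ⟨m.1, by omega⟩
        else Sum.inr ⟨m.1 + 2, by have := m.2; omega⟩))
    (Relation.EqvGen.setoid (eraseLowRel p j hj))

def eraseUpRel (p : TCP) (j : ℕ) (hj : j + 1 < p.k) :
    (Fin p.k ⊕ Fin p.l) → (Fin p.k ⊕ Fin p.l) → Prop :=
  fun x y => p.rel.r x y ∨ (x = Sum.inl ⟨j, by omega⟩ ∧ y = Sum.inl ⟨j + 1, hj⟩)

/-- Erasing the `j`-th and `(j+1)`-th upper points of `p`, first joining their blocks. -/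
def eraseUpperPair (p : TCP) (j : ℕ) (hj : j + 1 < p.k) : TCP where
  k := p.k - 2
  l := p.l
  upColor := fun m =>
    if hm : m.1 < j then p.upColor ⟨m.1, by omega⟩
    else p.upColor ⟨m.1 + 2, by have := m.2; omega⟩
  lowColor := p.lowColor
  rel := Setoid.comap
    (Sum.elim
      (fun m : Fin (p.k - 2) =>
        if hm : m.1 < j then (Sum.inl ⟨m.1, by omega⟩ : Fin p.k ⊕ Fin p.l)
        else Sum.inl ⟨m.1 + 2, by have := m.2; omega⟩)
      (fun i : Fin p.l => Sum.inr i))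
    (Relation.EqvGen.setoid (eraseUpRel p j hj))

/-- `p₁ ⊗ p₂ ∈ C` is in nest decomposed form, with the first point of `p₂` colored `x`
and the last point of `p₂` colored `y` (and those two points in the same block). -/
def InNDF (C : Set TCP) (x y : Color) (p₁ p₂ : TCP) : Prop :=
  tensor p₁ p₂ ∈ C ∧ Noncrossing (tensor p₁ p₂) ∧ p₁.k = 0 ∧ p₂.k = 0 ∧ 0 < p₁.l ∧
    ∃ h : 2 ≤ p₂.l,
      p₂.lowColor ⟨0, by omega⟩ = x ∧ p₂.lowColor ⟨p₂.l - 1, by omega⟩ = y ∧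
      p₂.rel.r (Sum.inr ⟨0, by omega⟩) (Sum.inr ⟨p₂.l - 1, by omega⟩)

/-- `K^C(x,y)`: the set of values `c(p₁)` over nest decomposed forms `p₁ ⊗ p₂ ∈ C` whose
outer block starts with color `x` and ends with color `y`. -/
def Kset (C : Set TCP) (x y : Color) : Set ℤ :=
  {n | ∃ p₁ p₂, InNDF C x y p₁ p₂ ∧ cval p₁ = n}

/-- The degree of reflection `k(C)`. -/
def kdeg (C : Set TCP) : ℕ := sInf {n : ℕ | 0 < n ∧ ∃ p ∈ C, cval p = (n : ℤ)}

/-- The local parameter `d(C)`. -/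
def ddeg (C : Set TCP) : ℕ := sInf {n : ℕ | 0 < n ∧ (n : ℤ) ∈ Kset C white black}

/-- The local parameter `r(C) = min {t ≥ 1 | t ∈ K^C(•,•)} − 1`. -/
def rdeg (C : Set TCP) : ℕ := sInf {t : ℕ | 1 ≤ t ∧ (t : ℤ) ∈ Kset C black black} - 1

/-- `C` is globally colorized if it contains `∘∘ ⊗ ••`. -/
def GloballyColorized (C : Set TCP) : Prop := wwbb ∈ C

def CaseO (C : Set TCP) : Prop := singPair ∉ C ∧ fourWBWB ∉ C
def CaseB (C : Set TCP) : Prop := singPair ∈ C ∧ fourWBWB ∉ C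
def CaseH (C : Set TCP) : Prop := singPair ∉ C ∧ fourWBWB ∈ C
def CaseS (C : Set TCP) : Prop := singPair ∈ C ∧ fourWBWB ∈ C

/-! Non-colored partitions. -/

/-- A non-colored partition with `k` upper and `l` lower points. -/
structure NCP where
  k : ℕ
  l : ℕ
  rel : Setoid (Fin k ⊕ Fin l)

namespace NCP

def splitPt (p q : NCP) :
    (Fin (p.k + q.k) ⊕ Fin (p.l + q.l)) → ((Fin p.k ⊕ Fin p.l) ⊕ (Fin q.k ⊕ Fin q.l))
  | .inl i => (finSumFinEquiv.symm i).elim (fun a => .inl (.inl a)) (fun b => .inr (.inl b))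
  | .inr j => (finSumFinEquiv.symm j).elim (fun a => .inl (.inr a)) (fun b => .inr (.inr b))

def tensor (p q : NCP) : NCP where
  k := p.k + q.k
  l := p.l + q.l
  rel := Setoid.comap (splitPt p q) (sumSetoid p.rel q.rel)

def compEmbMid (q p : NCP) (h : q.l = p.k) :
    (Fin p.k ⊕ Fin p.l) → ((Fin q.k ⊕ Fin q.l) ⊕ Fin p.l)
  | .inl i => .inl (.inr (Fin.cast h.symm i))
  | .inr j => .inr j

def compRel (q p : NCP) (h : q.l = p.k) :
    ((Fin q.k ⊕ Fin q.l) ⊕ Fin p.l) → ((Fin q.k ⊕ Fin q.l) ⊕ Fin p.l) → Prop :=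
  fun t t' =>
    (∃ x y, q.rel.r x y ∧ t = .inl x ∧ t' = .inl y) ∨
    (∃ x y, p.rel.r x y ∧ t = compEmbMid q p h x ∧ t' = compEmbMid q p h y)

def comp (q p : NCP) (h : q.l = p.k) : NCP where
  k := q.k
  l := p.l
  rel := Setoid.comap
    (Sum.elim (fun i : Fin q.k => (Sum.inl (Sum.inl i) : (Fin q.k ⊕ Fin q.l) ⊕ Fin p.l))
      (fun j : Fin p.l => Sum.inr j))
    (Relation.EqvGen.setoid (compRel q p h))

def invol (p : NCP) : NCP where
  k := p.l
  l := p.k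
  rel := Setoid.comap Sum.swap p.rel

/-- The non-colored identity partition. -/
def idN : NCP := ⟨1, 1, ⊤⟩

/-- The non-colored pair partition on two lower points. -/
def pairN : NCP := ⟨0, 2, ⊤⟩

end NCP

/-- A category of non-colored partitions. -/
structure IsCategoryN (D : Set NCP) : Prop where
  tensor_mem : ∀ p ∈ D, ∀ q ∈ D, NCP.tensor p q ∈ D
  comp_mem : ∀ q ∈ D, ∀ p ∈ D, ∀ h : q.l = p.k, NCP.comp q p h ∈ D
  invol_mem : ∀ p ∈ D, NCP.invol p ∈ D
  id_mem : NCP.idN ∈ D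
  pair_mem : NCP.pairN ∈ D

/-- The map `Ψ` forgetting the colors of a two-colored partition. -/
def forget (p : TCP) : NCP := ⟨p.k, p.l, p.rel⟩

/-! ### Gluing two classes of an equivalence relation -/

/-- The equivalence relation obtained from `r` by joining the classes of `u` and `v`. -/
def glue {α : Type*} (r : Setoid α) (u v : α) : Setoid α where
  r x y := r x y ∨ (r x u ∧ r v y) ∨ (r x v ∧ r u y)
  iseqv := by
    constructor
    · exact fun x => Or.inl (r.refl x)
    · rintro x y (h | ⟨h, h'⟩ | ⟨h, h'⟩)
      · exact Or.inl (r.symm h)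
      · exact Or.inr (Or.inr ⟨r.symm h', r.symm h⟩)
      · exact Or.inr (Or.inl ⟨r.symm h', r.symm h⟩)
    · rintro x y z (h | ⟨h, h'⟩ | ⟨h, h'⟩) (k | ⟨k, k'⟩ | ⟨k, k'⟩)
      · exact Or.inl (r.trans h k)
      · exact Or.inr (Or.inl ⟨r.trans h k, k'⟩)
      · exact Or.inr (Or.inr ⟨r.trans h k, k'⟩)
      · exact Or.inr (Or.inl ⟨h, r.trans h' k⟩)
      · exact Or.inr (Or.inl ⟨h, k'⟩)
      · exact Or.inl (r.trans h k')
      · exact Or.inr (Or.inr ⟨h, r.trans h' k⟩)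
      · exact Or.inl (r.trans h k')
      · exact Or.inr (Or.inr ⟨h, k'⟩)

lemma glue_apply {α : Type*} (r : Setoid α) (u v x y : α) :
    (glue r u v) x y ↔ r x y ∨ (r x u ∧ r v y) ∨ (r x v ∧ r u y) := Iff.rfl

/-- `r` is noncrossing, with respect to the positions `f`, on the points whose position
satisfies `P`. -/
def NoncrossingOn {α : Type*} (f : α → ℕ) (P : ℕ → Prop) (r : Setoid α) : Prop :=
  ∀ a b x y : α, P (f a) → P (f b) → P (f x) → P (f y) →
    f a < f b → f b < f x → f x < f y → r a x → r b y → r a b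

/-- Gluing two neighbouring points preserves noncrossingness. -/
lemma NoncrossingOn.glue {α : Type*} {f : α → ℕ} (hf : Function.Injective f) {P : ℕ → Prop}
    {r : Setoid α} (hr : NoncrossingOn f P r) {u v : α} (hu : P (f u)) (hv : P (f v))
    (huv : f u < f v) (hgap : ∀ w, P (f w) → ¬ (f u < f w ∧ f w < f v)) :
    NoncrossingOn f P (glue r u v) := by
  have sep : ∀ {b y}, P (f b) → P (f y) → r b y → ¬ r b u → ¬ r b v →
      f b ≠ f u ∧ f b ≠ f v ∧ f y ≠ f u ∧ f y ≠ f v := by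
    intro b y _ _ hby hbu hbv
    refine ⟨fun h => ?_, fun h => ?_, fun h => ?_, fun h => ?_⟩
    · exact hbu (hf h ▸ r.refl _)
    · exact hbv (hf h ▸ r.refl _)
    · exact hbu (hf h ▸ hby)
    · exact hbv (hf h ▸ hby)
  intro a b x y ha hb hx hy hab hbx hxy hax hby
  rw [glue_apply] at hax hby ⊢
  by_contra hcon
  simp only [not_or, not_and] at hcon
  obtain ⟨hn, hn1, hn2⟩ := hcon
  have ga := hgap a ha
  have gb := hgap b hb
  have gx := hgap x hx
  have gy := hgap y hy
  have key1 : ∀ u' v', (u' = u ∧ v' = v ∨ u' = v ∧ v' = u) → r a u' → r v' x → r b y → False := by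
    intro u' v' huv' hau hvx hby
    have hbu : ¬ r b u := fun h => by
      rcases huv' with ⟨rfl, rfl⟩ | ⟨rfl, rfl⟩
      · exact hn (r.trans hau (r.symm h))
      · exact hn2 hau (r.symm h)
    have hbv : ¬ r b v := fun h => by
      rcases huv' with ⟨rfl, rfl⟩ | ⟨rfl, rfl⟩
      · exact hn1 hau (r.symm h)
      · exact hn (r.trans hau (r.symm h))
    have hbv' : ¬ r b v' := by rcases huv' with ⟨rfl, rfl⟩ | ⟨rfl, rfl⟩ <;> assumption
    obtain ⟨s1, s2, s3, s4⟩ := sep hb hy hby hbu hbv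
    have pu' : P (f u') := by rcases huv' with ⟨rfl, rfl⟩ | ⟨rfl, rfl⟩ <;> assumption
    have pv' : P (f v') := by rcases huv' with ⟨rfl, rfl⟩ | ⟨rfl, rfl⟩ <;> assumption
    by_cases hin : f b < f u' ∧ f u' < f y
    · exact hn (hr a b u' y ha hb pu' hy hab hin.1 hin.2 hau hby)
    · have hout : f v' < f b ∨ f y < f v' := by
        rcases huv' with ⟨rfl, rfl⟩ | ⟨rfl, rfl⟩ <;> omega
      rcases hout with h | h
      · exact hbv' (r.symm (hr v' b x y pv' hb hx hy h hbx hxy hvx hby))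
      · exact hbv' (r.trans (hr b x y v' hb hx hy pv' hbx hxy h hby (r.symm hvx)) (r.symm hvx))
  have key2 : ∀ u' v', (u' = u ∧ v' = v ∨ u' = v ∧ v' = u) → r b u' → r v' y → r a x → False := by
    intro u' v' huv' hbu hvy hax
    have hau : ¬ r a u := fun h => by
      rcases huv' with ⟨rfl, rfl⟩ | ⟨rfl, rfl⟩
      · exact hn (r.trans h (r.symm hbu))
      · exact hn1 h (r.symm hbu)
    have hav : ¬ r a v := fun h => by
      rcases huv' with ⟨rfl, rfl⟩ | ⟨rfl, rfl⟩
      · exact hn2 h (r.symm hbu)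
      · exact hn (r.trans h (r.symm hbu))
    have hav' : ¬ r a v' := by rcases huv' with ⟨rfl, rfl⟩ | ⟨rfl, rfl⟩ <;> assumption
    have hau' : ¬ r a u' := by rcases huv' with ⟨rfl, rfl⟩ | ⟨rfl, rfl⟩ <;> assumption
    obtain ⟨s1, s2, s3, s4⟩ := sep ha hx hax hau hav
    have pu' : P (f u') := by rcases huv' with ⟨rfl, rfl⟩ | ⟨rfl, rfl⟩ <;> assumption
    have pv' : P (f v') := by rcases huv' with ⟨rfl, rfl⟩ | ⟨rfl, rfl⟩ <;> assumption
    by_cases hin : f a < f v' ∧ f v' < f x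
    · exact hav' (hr a v' x y ha pv' hx hy hin.1 hin.2 hxy hax hvy)
    · have hout : f u' < f a ∨ f x < f u' := by
        rcases huv' with ⟨rfl, rfl⟩ | ⟨rfl, rfl⟩ <;> omega
      rcases hout with h | h
      · exact hau' (r.symm (hr u' a b x pu' ha hb hx h hab hbx (r.symm hbu) hax))
      · exact hn (hr a b x u' ha hb hx pu' hab hbx h hax hbu)
  rcases hax with hax | ⟨h1, h2⟩ | ⟨h1, h2⟩
  · rcases hby with hby | ⟨k1, k2⟩ | ⟨k1, k2⟩
    · exact hn (hr a b x y ha hb hx hy hab hbx hxy hax hby)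
    · exact key2 u v (Or.inl ⟨rfl, rfl⟩) k1 k2 hax
    · exact key2 v u (Or.inr ⟨rfl, rfl⟩) k1 k2 hax
  · rcases hby with hby | ⟨k1, k2⟩ | ⟨k1, k2⟩
    · exact key1 u v (Or.inl ⟨rfl, rfl⟩) h1 h2 hby
    · exact hn (r.trans h1 (r.symm k1))
    · exact hn1 h1 (r.symm k1)
  · rcases hby with hby | ⟨k1, k2⟩ | ⟨k1, k2⟩
    · exact key1 v u (Or.inr ⟨rfl, rfl⟩) h1 h2 hby
    · exact hn2 h1 (r.symm k1)
    · exact hn (r.trans h1 (r.symm k1))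

/-! ### Tinted partitions -/

/-- The color of a point as an element of `ZMod 2`. -/
def hue (c : Color) : ZMod 2 := if c then 1 else 0

lemma hue_not (c : Color) : hue (!c) = hue c + 1 := by
  cases c <;> decide

lemma hue_injective : Function.Injective hue := by
  intro c d h
  cases c <;> cases d <;> first | rfl | exact absurd h (by decide)

/-- The color of a point, shifted by the parity of its place in its row. -/
def tint (p : TCP) : Fin p.k ⊕ Fin p.l → ZMod 2 :=
  Sum.elim (fun i => hue (p.upColor i) + (i.1 : ZMod 2)) (fun j => hue (p.lowColor j) + (j.1 : ZMod 2))

/-- Noncrossing partitions with blocks of even size (every mod-2 function constant on blocks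
sums to zero) and of constant tint. -/
structure Good (p : TCP) : Prop where
  nc : Noncrossing p
  even : ∀ χ : Fin p.k ⊕ Fin p.l → ZMod 2, (∀ x y, p.rel x y → χ x = χ y) → ∑ x, χ x = 0
  tint_eq : ∀ x y, p.rel x y → tint p x = tint p y

lemma Good.parity {p : TCP} (hp : Good p) : (p.k : ZMod 2) = p.l := by
  have h := hp.even (fun _ => 1) (fun _ _ _ => rfl)
  simp only [Finset.sum_const, Finset.card_univ, Fintype.card_sum, Fintype.card_fin,
    nsmul_eq_mul, mul_one, Nat.cast_add] at h
  exact CharTwo.add_eq_zero.mp h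

lemma linePos_injective (p : TCP) : Function.Injective (linePos p) := by
  rintro (⟨i, hi⟩ | ⟨i, hi⟩) (⟨j, hj⟩ | ⟨j, hj⟩) h <;> simp [linePos] at h ⊢ <;> omega

lemma linePos_lt (p : TCP) (x) : linePos p x < p.k + p.l := by
  rcases x with (⟨i, hi⟩ | ⟨i, hi⟩) <;> simp [linePos] <;> omega

/-! ### The good partitions form a category -/

/-- The inclusion of the points of the left factor of a tensor product. -/
def embL (p q : TCP) : Fin p.k ⊕ Fin p.l → Fin (tensor p q).k ⊕ Fin (tensor p q).l
  | .inl i => .inl (Fin.castAdd q.k i)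
  | .inr j => .inr (Fin.castAdd q.l j)

/-- The inclusion of the points of the right factor of a tensor product. -/
def embR (p q : TCP) : Fin q.k ⊕ Fin q.l → Fin (tensor p q).k ⊕ Fin (tensor p q).l
  | .inl i => .inl (Fin.natAdd p.k i)
  | .inr j => .inr (Fin.natAdd p.l j)

lemma splitPt_embL (p q : TCP) (x) : splitPt p q (embL p q x) = .inl x := by
  rcases x with x | x <;> simp [splitPt, embL]

lemma splitPt_embR (p q : TCP) (x) : splitPt p q (embR p q x) = .inr x := by
  rcases x with x | x <;> simp [splitPt, embR]

lemma tensor_cases (p q : TCP) (t : Fin (tensor p q).k ⊕ Fin (tensor p q).l) :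
    (∃ x, t = embL p q x) ∨ ∃ x, t = embR p q x := by
  rcases t with t | t
  · refine Fin.addCases (fun i => ?_) (fun i => ?_) t
    · exact Or.inl ⟨.inl i, rfl⟩
    · exact Or.inr ⟨.inl i, rfl⟩
  · refine Fin.addCases (fun i => ?_) (fun i => ?_) t
    · exact Or.inl ⟨.inr i, rfl⟩
    · exact Or.inr ⟨.inr i, rfl⟩

lemma tensor_rel_LL (p q : TCP) (x y) : (tensor p q).rel (embL p q x) (embL p q y) ↔ p.rel x y := by
  change sumRel _ _ (splitPt p q _) (splitPt p q _) ↔ _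
  rw [splitPt_embL, splitPt_embL]; rfl

lemma tensor_rel_RR (p q : TCP) (x y) : (tensor p q).rel (embR p q x) (embR p q y) ↔ q.rel x y := by
  change sumRel _ _ (splitPt p q _) (splitPt p q _) ↔ _
  rw [splitPt_embR, splitPt_embR]; rfl

lemma tensor_rel_LR (p q : TCP) (x y) : ¬ (tensor p q).rel (embL p q x) (embR p q y) := by
  change ¬ sumRel _ _ (splitPt p q _) (splitPt p q _)
  rw [splitPt_embL, splitPt_embR]; exact id

lemma tensor_rel_RL (p q : TCP) (x y) : ¬ (tensor p q).rel (embR p q x) (embL p q y) :=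
  fun h => tensor_rel_LR p q y x ((tensor p q).rel.symm h)

lemma linePos_embL (p q : TCP) (x) : linePos (tensor p q) (embL p q x) = q.k + linePos p x := by
  rcases x with ⟨i, hi⟩ | ⟨i, hi⟩ <;> simp [linePos, embL, tensor] <;> omega

lemma linePos_embR (p q : TCP) (x) :
    (linePos (tensor p q) (embR p q x) = linePos q x ∧ linePos q x < q.k) ∨
    (linePos (tensor p q) (embR p q x) = p.k + p.l + linePos q x ∧ q.k ≤ linePos q x) := by
  rcases x with ⟨i, hi⟩ | ⟨i, hi⟩
  · left; simp [linePos, embR, tensor]; omega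
  · right; simp [linePos, embR, tensor]; omega

lemma tint_embL (p q : TCP) (x) : tint (tensor p q) (embL p q x) = tint p x := by
  rcases x with x | x <;> simp [tint, embL, tensor]

lemma tint_embR (p q : TCP) (h : (p.k : ZMod 2) = p.l) (x) :
    tint (tensor p q) (embR p q x) = p.k + tint q x := by
  rcases x with x | x
  · simp [tint, embR, tensor]; ring
  · simp [tint, embR, tensor, h]; ring

lemma sum_tensor (p q : TCP) (χ : Fin (tensor p q).k ⊕ Fin (tensor p q).l → ZMod 2) :
    ∑ x, χ x = ∑ x, χ (embL p q x) + ∑ x, χ (embR p q x) := by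
  rw [Fintype.sum_sum_type, Fintype.sum_sum_type, Fintype.sum_sum_type]
  have h1 := Fin.sum_univ_add (fun i : Fin (p.k + q.k) => χ (.inl i))
  have h2 := Fin.sum_univ_add (fun i : Fin (p.l + q.l) => χ (.inr i))
  have h := congrArg₂ (· + ·) h1 h2
  refine h.trans ?_
  exact add_add_add_comm _ _ _ _

lemma Good.tensor {p q : TCP} (hp : Good p) (hq : Good q) : Good (tensor p q) where
  nc := by
    intro a b x y hab hbx hxy hax hby
    obtain ⟨a, rfl⟩ | ⟨a, rfl⟩ := tensor_cases p q a <;>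
    obtain ⟨x, rfl⟩ | ⟨x, rfl⟩ := tensor_cases p q x <;>
    first
    | exact absurd hax (tensor_rel_LR p q _ _)
    | exact absurd hax (tensor_rel_RL p q _ _)
    | skip
    all_goals
      obtain ⟨b, rfl⟩ | ⟨b, rfl⟩ := tensor_cases p q b <;>
      obtain ⟨y, rfl⟩ | ⟨y, rfl⟩ := tensor_cases p q y <;>
      first
      | exact absurd hby (tensor_rel_LR p q _ _)
      | exact absurd hby (tensor_rel_RL p q _ _)
      | skip
    · simp only [linePos_embL, add_lt_add_iff_left] at hab hbx hxy
      exact (tensor_rel_LL p q _ _).2 (hp.nc a b x y hab hbx hxy ((tensor_rel_LL p q _ _).1 hax)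
        ((tensor_rel_LL p q _ _).1 hby))
    · rw [linePos_embL] at hab hbx
      have := linePos_embR p q b
      have := linePos_lt p a
      have := linePos_lt p x
      omega
    · rw [linePos_embL] at hbx hxy
      have := linePos_embR p q x
      have := linePos_lt p b
      have := linePos_lt p y
      omega
    · have h1 := linePos_embR p q a
      have h2 := linePos_embR p q b
      have h3 := linePos_embR p q x
      have h4 := linePos_embR p q y
      exact (tensor_rel_RR p q _ _).2 (hq.nc a b x y (by omega) (by omega) (by omega)
        ((tensor_rel_RR p q _ _).1 hax) ((tensor_rel_RR p q _ _).1 hby))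
  even := by
    intro χ hχ
    rw [sum_tensor, hp.even _ (fun x y h => hχ _ _ ((tensor_rel_LL p q _ _).2 h)),
      hq.even _ (fun x y h => hχ _ _ ((tensor_rel_RR p q _ _).2 h)), add_zero]
  tint_eq := by
    intro x y hxy
    obtain ⟨x, rfl⟩ | ⟨x, rfl⟩ := tensor_cases p q x <;>
    obtain ⟨y, rfl⟩ | ⟨y, rfl⟩ := tensor_cases p q y
    · rw [tint_embL, tint_embL]
      exact hp.tint_eq _ _ ((tensor_rel_LL p q _ _).1 hxy)
    · exact absurd hxy (tensor_rel_LR p q _ _)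
    · exact absurd hxy (tensor_rel_RL p q _ _)
    · rw [tint_embR p q hp.parity, tint_embR p q hp.parity,
        hq.tint_eq _ _ ((tensor_rel_RR p q _ _).1 hxy)]

lemma linePos_swap (p : TCP) (x : Fin (invol p).k ⊕ Fin (invol p).l) :
    linePos (invol p) x + linePos p x.swap + 1 = p.k + p.l := by
  rcases x with ⟨i, hi⟩ | ⟨i, hi⟩ <;> simp [linePos, invol] at hi ⊢ <;> omega

lemma Good.invol {p : TCP} (hp : Good p) : Good (invol p) where
  nc := by
    intro a b x y hab hbx hxy hax hby
    have h1 := linePos_swap p a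
    have h2 := linePos_swap p b
    have h3 := linePos_swap p x
    have h4 := linePos_swap p y
    have hax' : p.rel a.swap x.swap := hax
    have hby' : p.rel b.swap y.swap := hby
    have h := hp.nc y.swap x.swap b.swap a.swap (by omega) (by omega) (by omega)
      (p.rel.symm hby') (p.rel.symm hax')
    exact p.rel.trans hax' (p.rel.trans (p.rel.symm h) (p.rel.symm hby'))
  even := by
    intro χ hχ
    have h := hp.even (fun x => χ x.swap) (fun x y hxy => hχ _ _ (by
      change p.rel x.swap.swap y.swap.swap
      rwa [Sum.swap_swap, Sum.swap_swap]))
    rw [Fintype.sum_sum_type] at h ⊢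
    rw [add_comm]
    exact h
  tint_eq := by
    have key : ∀ x : Fin p.l ⊕ Fin p.k, tint (CTCP.invol p) x = tint p x.swap := by
      rintro (x | x) <;> rfl
    intro x y hxy
    exact (key x).trans ((hp.tint_eq _ _ hxy).trans (key y).symm)

lemma good_idPart (c : Color) : Good (idPart c) where
  nc := fun _ _ _ _ _ _ _ _ _ => trivial
  even := by
    intro χ hχ
    rw [Fintype.sum_sum_type]
    change ∑ i : Fin 1, χ (.inl i) + ∑ i : Fin 1, χ (.inr i) = 0
    rw [Fin.sum_univ_one, Fin.sum_univ_one, hχ (.inl (0 : Fin 1)) (.inr (0 : Fin 1)) trivial]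
    exact CharTwo.add_self_eq_zero _
  tint_eq := by
    rintro (⟨i, hi⟩ | ⟨i, hi⟩) (⟨j, hj⟩ | ⟨j, hj⟩) - <;> simp [idPart] at hi hj <;> subst hi hj <;> rfl

lemma good_block (n : ℕ) (col : Fin n → Color) (hn : (n : ZMod 2) = 0)
    (ht : ∀ i j : Fin n, hue (col i) + (i.1 : ZMod 2) = hue (col j) + (j.1 : ZMod 2)) :
    Good (mkLower n col fun _ => 0) := by
  have hrel : ∀ x y, (mkLower n col fun _ => 0).rel x y := by
    rintro (x | x) (y | y)
    · exact x.elim0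
    · exact x.elim0
    · exact y.elim0
    · rfl
  refine ⟨fun _ _ _ _ _ _ _ _ _ => hrel _ _, fun χ hχ => ?_, ?_⟩
  · by_cases hne : Nonempty (Fin (mkLower n col fun _ => 0).k ⊕ Fin (mkLower n col fun _ => 0).l)
    · obtain ⟨x⟩ := hne
      rw [Finset.sum_congr rfl (fun y _ => hχ y x (hrel _ _)), Finset.sum_const, Finset.card_univ,
        Fintype.card_sum, Fintype.card_fin, Fintype.card_fin, nsmul_eq_mul]
      have : (((mkLower n col fun _ => 0).k + (mkLower n col fun _ => 0).l : ℕ) : ZMod 2) = 0 := by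
        simpa [mkLower] using hn
      rw [this, zero_mul]
    · rw [not_nonempty_iff] at hne
      exact Finset.sum_of_isEmpty _
  · rintro (x | x) (y | y) -
    · exact x.elim0
    · exact x.elim0
    · exact y.elim0
    · exact ht x y

lemma good_pairLower (c : Color) : Good (pairLower c (!c)) := by
  refine good_block 2 _ (by decide) ?_
  intro i j
  fin_cases i <;> fin_cases j <;> cases c <;> decide

lemma good_fourWBWB : Good fourWBWB := by
  refine good_block 4 _ (by decide) ?_
  intro i j
  fin_cases i <;> fin_cases j <;> decide

/-- The inclusion of the points of a composition into the points of the glued diagram. -/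
def compOuter (q p : TCP) (h : q.l = p.k) :
    Fin (comp q p h).k ⊕ Fin (comp q p h).l → (Fin q.k ⊕ Fin q.l) ⊕ Fin p.l :=
  Sum.elim (fun i : Fin q.k => (Sum.inl (Sum.inl i) : (Fin q.k ⊕ Fin q.l) ⊕ Fin p.l))
    (fun j : Fin p.l => Sum.inr j)

/-- The equivalence relation of the glued diagram underlying a composition. -/
abbrev compSetoid (q p : TCP) (h : q.l = p.k) : Setoid ((Fin q.k ⊕ Fin q.l) ⊕ Fin p.l) :=
  Relation.EqvGen.setoid (compRel q p h)

lemma comp_rel (q p : TCP) (h : q.l = p.k) (x y) :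
    (comp q p h).rel x y ↔ compSetoid q p h (compOuter q p h x) (compOuter q p h y) := Iff.rfl

lemma compSetoid_left (q p : TCP) (h : q.l = p.k) {x y} (hxy : q.rel x y) :
    compSetoid q p h (.inl x) (.inl y) :=
  Relation.EqvGen.rel _ _ (Or.inl ⟨x, y, hxy, rfl, rfl⟩)

lemma compSetoid_right (q p : TCP) (h : q.l = p.k) {x y} (hxy : p.rel x y) :
    compSetoid q p h (compEmbMid q p h x) (compEmbMid q p h y) :=
  Relation.EqvGen.rel _ _ (Or.inr ⟨x, y, hxy, rfl, rfl⟩)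

/-- Every equivalence relation on the glued diagram containing the blocks of both factors
contains the glued relation. -/
lemma compSetoid_le (q p : TCP) (h : q.l = p.k) (s : Setoid ((Fin q.k ⊕ Fin q.l) ⊕ Fin p.l))
    (hq : ∀ x y, q.rel x y → s (.inl x) (.inl y))
    (hp : ∀ x y, p.rel x y → s (compEmbMid q p h x) (compEmbMid q p h y)) {t t'}
    (ht : compSetoid q p h t t') : s t t' := by
  have : compSetoid q p h ≤ s := by
    refine Setoid.eqvGen_le ?_
    rintro t t' (⟨x, y, hxy, rfl, rfl⟩ | ⟨x, y, hxy, rfl, rfl⟩)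
    · exact hq x y hxy
    · exact hp x y hxy
  exact this ht

lemma Good.comp_tint {q p : TCP} (hq : Good q) (hp : Good p) (h : q.l = p.k)
    (hc : ColorsMatch q p h) (x y) (hxy : (comp q p h).rel x y) :
    tint (comp q p h) x = tint (comp q p h) y := by
  let g : (Fin q.k ⊕ Fin q.l) ⊕ Fin p.l → ZMod 2 := Sum.elim (tint q) (fun j => tint p (.inr j))
  have hg : ∀ x, g (compEmbMid q p h x) = tint p x := by
    rintro (i | j)
    · have := hc (Fin.cast h.symm i)
      simp [g, compEmbMid, tint, this]
    · rfl
  have ho : ∀ x, g (compOuter q p h x) = tint (comp q p h) x := by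
    rintro (i | j) <;> rfl
  rw [← ho, ← ho]
  refine compSetoid_le q p h (Setoid.ker g) hq.tint_eq ?_ ((comp_rel q p h x y).1 hxy)
  intro x y hxy
  rw [Setoid.ker_def, hg, hg]
  exact hp.tint_eq _ _ hxy

open Classical in
/-- Extension by zero of a function constant on classes, along the map `e`. -/
def extendZero {α β : Type*} (s : Setoid β) (e : α → β) (χ : α → ZMod 2) (t : β) : ZMod 2 :=
  if h : ∃ x, s (e x) t then χ h.choose else 0

lemma extendZero_apply {α β : Type*} (s : Setoid β) (e : α → β) (χ : α → ZMod 2)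
    (hχ : ∀ x y, s (e x) (e y) → χ x = χ y) (x : α) : extendZero s e χ (e x) = χ x := by
  have h : ∃ y, s (e y) (e x) := ⟨x, s.refl _⟩
  rw [extendZero, dif_pos h]
  exact hχ _ _ h.choose_spec

lemma extendZero_congr {α β : Type*} (s : Setoid β) (e : α → β) (χ : α → ZMod 2)
    (hχ : ∀ x y, s (e x) (e y) → χ x = χ y) {t t' : β} (htt : s t t') :
    extendZero s e χ t = extendZero s e χ t' := by
  by_cases h : ∃ x, s (e x) t
  · have h' : ∃ x, s (e x) t' := h.imp fun x hx => s.trans hx htt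
    rw [extendZero, extendZero, dif_pos h, dif_pos h']
    exact hχ _ _ (s.trans h.choose_spec (s.trans htt (s.symm h'.choose_spec)))
  · have h' : ¬ ∃ x, s (e x) t' := fun h' => h (h'.imp fun x hx => s.trans hx (s.symm htt))
    rw [extendZero, extendZero, dif_neg h, dif_neg h']

lemma Good.comp_even {q p : TCP} (hq : Good q) (hp : Good p) (h : q.l = p.k)
    (χ : Fin (comp q p h).k ⊕ Fin (comp q p h).l → ZMod 2)
    (hχ : ∀ x y, (comp q p h).rel x y → χ x = χ y) : ∑ x, χ x = 0 := by
  let ψ := extendZero (compSetoid q p h) (compOuter q p h) χ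
  have hψ : ∀ x, ψ (compOuter q p h x) = χ x := extendZero_apply _ _ χ hχ
  have h1 := hq.even (fun x => ψ (.inl x))
    (fun x y hxy => extendZero_congr _ (compOuter q p h) χ hχ (compSetoid_left q p h hxy))
  have h2 := hp.even (fun x => ψ (compEmbMid q p h x))
    (fun x y hxy => extendZero_congr _ (compOuter q p h) χ hχ (compSetoid_right q p h hxy))
  rw [Fintype.sum_sum_type] at h1 h2 ⊢
  have hu : ∑ i, χ (.inl i) = ∑ i : Fin q.k, ψ (.inl (.inl i)) :=
    Finset.sum_congr rfl fun i _ => (hψ (.inl i)).symm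
  have hl : ∑ j, χ (.inr j) = ∑ j : Fin p.l, ψ (compEmbMid q p h (.inr j)) :=
    Finset.sum_congr rfl fun j _ => (hψ (.inr j)).symm
  have hm : ∑ j : Fin q.l, ψ (.inl (.inr j)) = ∑ i : Fin p.k, ψ (compEmbMid q p h (.inl i)) :=
    ((finCongr h.symm).sum_comp fun j => ψ (.inl (.inr j))).symm
  rw [hu, hl, CharTwo.add_eq_zero.mp h1, hm]
  exact h2

/-- Noncrossingness of a composition: the two diagrams are placed next to each other on a line
and the middle points are glued in pairs, starting from the innermost pair. -/
lemma Good.comp_nc {q p : TCP} (hq : Good q) (hp : Good p) (h : q.l = p.k) :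
    Noncrossing (comp q p h) := by
  let f : (Fin q.k ⊕ Fin q.l) ⊕ (Fin p.k ⊕ Fin p.l) → ℕ :=
    Sum.elim (linePos q) (fun y => q.k + q.l + linePos p y)
  let π : (Fin q.k ⊕ Fin q.l) ⊕ (Fin p.k ⊕ Fin p.l) → (Fin q.k ⊕ Fin q.l) ⊕ Fin p.l :=
    Sum.elim Sum.inl (compEmbMid q p h)
  have hf : Function.Injective f := by
    rintro (x | x) (y | y) hxy
    · exact congrArg _ (linePos_injective q hxy)
    · have := linePos_lt q x
      simp only [f, Sum.elim_inl, Sum.elim_inr] at hxy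
      omega
    · have := linePos_lt q y
      simp only [f, Sum.elim_inl, Sum.elim_inr] at hxy
      omega
    · exact congrArg _ (linePos_injective p (Nat.add_left_cancel hxy))
  have hfl : ∀ x, f (.inl x) < q.k + q.l := linePos_lt q
  have hfr : ∀ x, q.k + q.l ≤ f (.inr x) := fun x => Nat.le_add_right _ _
  have main : ∀ t, t ≤ q.l → ∃ r : Setoid ((Fin q.k ⊕ Fin q.l) ⊕ (Fin p.k ⊕ Fin p.l)),
      sumSetoid q.rel p.rel ≤ r ∧
      (∀ j : Fin q.l, q.l ≤ j.1 + t → r (.inl (.inr j)) (.inr (.inl (Fin.cast h j)))) ∧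
      (∀ x y, r x y → compSetoid q p h (π x) (π y)) ∧
      NoncrossingOn f (fun n => n + t < q.k + q.l ∨ q.k + q.l + t ≤ n) r := by
    intro t
    induction t with
    | zero =>
      intro _
      refine ⟨sumSetoid q.rel p.rel, le_rfl, fun j hj => absurd j.2 (by omega), ?_, ?_⟩
      · rintro (x | x) (y | y) hxy
        · exact compSetoid_left q p h hxy
        · exact hxy.elim
        · exact hxy.elim
        · exact compSetoid_right q p h hxy
      · rintro a b x y - - - - hab hbx hxy hax hby
        rcases a with a | a <;> rcases x with x | x <;> first | exact hax.elim | skip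
        · rcases b with b | b <;> rcases y with y | y <;> first | exact hby.elim | skip
          · exact hq.nc a b x y hab hbx hxy hax hby
          · have := hfr b; have := hfl x; omega
        · rcases b with b | b <;> rcases y with y | y <;> first | exact hby.elim | skip
          · have := hfl b; have := hfr a; omega
          · exact hp.nc a b x y (Nat.lt_of_add_lt_add_left hab) (Nat.lt_of_add_lt_add_left hbx)
              (Nat.lt_of_add_lt_add_left hxy) hax hby
    | succ t ih =>
      intro ht
      obtain ⟨r, hr, hmid, hπ, hnc⟩ := ih (by omega)
      let j₀ : Fin q.l := ⟨q.l - 1 - t, by omega⟩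
      let u : (Fin q.k ⊕ Fin q.l) ⊕ (Fin p.k ⊕ Fin p.l) := .inl (.inr j₀)
      let v : (Fin q.k ⊕ Fin q.l) ⊕ (Fin p.k ⊕ Fin p.l) := .inr (.inl (Fin.cast h j₀))
      have hu : f u = q.k + q.l - 1 - t := by
        change q.k + (q.l - 1 - t) = _
        omega
      have hv : f v = q.k + q.l + t := by
        change q.k + q.l + (p.k - 1 - (q.l - 1 - t)) = _
        omega
      have huv : compSetoid q p h (π u) (π v) := (compSetoid q p h).refl _
      refine ⟨CTCP.glue r u v, fun x y hxy => Or.inl (hr hxy), ?_, ?_, ?_⟩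
      · intro j hj
        by_cases hjt : q.l ≤ j.1 + t
        · exact Or.inl (hmid j hjt)
        · have : j = j₀ := Fin.ext (by change j.1 = q.l - 1 - t; omega)
          subst this
          exact Or.inr (Or.inl ⟨r.refl _, r.refl _⟩)
      · rintro x y (hxy | ⟨h1, h2⟩ | ⟨h1, h2⟩)
        · exact hπ _ _ hxy
        · exact (compSetoid q p h).trans (hπ _ _ h1) ((compSetoid q p h).trans huv (hπ _ _ h2))
        · exact (compSetoid q p h).trans (hπ _ _ h1)
            ((compSetoid q p h).trans ((compSetoid q p h).symm huv) (hπ _ _ h2))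
      · have := hnc.glue hf (u := u) (v := v) (by omega) (by omega) (by omega)
          (fun w hw => by omega)
        exact fun a b x y ha hb hx hy => this a b x y (by omega) (by omega) (by omega) (by omega)
  obtain ⟨r, hr, hmid, hπ, hnc⟩ := main q.l le_rfl
  let σ : (Fin q.k ⊕ Fin q.l) ⊕ Fin p.l → (Fin q.k ⊕ Fin q.l) ⊕ (Fin p.k ⊕ Fin p.l) :=
    Sum.map id Sum.inr
  have hσ : ∀ {t t'}, compSetoid q p h t t' → r (σ t) (σ t') := by
    intro t t' htt
    have hm : ∀ x, r (σ (compEmbMid q p h x)) (.inr x) := by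
      rintro (i | j)
      · exact hmid (Fin.cast h.symm i) (Nat.le_add_left _ _)
      · exact r.refl _
    refine compSetoid_le q p h (Setoid.comap σ r) (fun x y hxy => hr ?_) (fun x y hxy => ?_) htt
    · exact hxy
    · have hxy' : r (.inr x) (.inr y) := hr hxy
      exact r.trans (hm x) (r.trans hxy' (r.symm (hm y)))
  have hπσ : ∀ t, π (σ t) = t := by
    rintro ((t | t) | t) <;> rfl
  have hpos : ∀ x, (linePos (comp q p h) x < q.k ∧ f (σ (compOuter q p h x)) = linePos (comp q p h) x)
      ∨ (q.k ≤ linePos (comp q p h) x ∧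
        f (σ (compOuter q p h x)) = linePos (comp q p h) x + q.l + q.l) := by
    rintro (⟨i, hi⟩ | ⟨j, hj⟩)
    · left
      change i < q.k at hi
      change q.k - 1 - i < q.k ∧ q.k - 1 - i = q.k - 1 - i
      omega
    · right
      change q.k ≤ q.k + j ∧ q.k + q.l + (p.k + j) = q.k + j + q.l + q.l
      omega
  intro a b x y hab hbx hxy hax hby
  have ha := hpos a
  have hb := hpos b
  have hx := hpos x
  have hy := hpos y
  have := hπ _ _ (hnc _ _ _ _ (by omega) (by omega) (by omega) (by omega) (by omega) (by omega)
    (by omega) (hσ ((comp_rel q p h a x).1 hax)) (hσ ((comp_rel q p h b y).1 hby)))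
  rw [hπσ, hπσ] at this
  exact this

lemma isCategory_good : IsCategory {p | Good p} where
  tensor_mem _ hp _ hq := hp.tensor hq
  comp_mem _ hq _ hp h hc := ⟨hq.comp_nc hp h, hq.comp_even hp h, hq.comp_tint hp h hc⟩
  invol_mem _ hp := hp.invol
  idw_mem := good_idPart white
  idb_mem := good_idPart black
  pairwb_mem := good_pairLower white
  pairbw_mem := good_pairLower black

/-! ### Partitions cut out of a line -/

/-- The partition with `k` upper and `l` lower points obtained from colors and blocks on a line
of `k + l` points by rotating the first `k` points to the upper row. -/
def cut (k l : ℕ) (col : ℕ → Color) (R : Setoid ℕ) : TCP where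
  k := k
  l := l
  upColor := fun i => !(col (k - 1 - i.1))
  lowColor := fun j => col (k + j.1)
  rel := Setoid.comap (Sum.elim (fun i : Fin k => k - 1 - i.1) (fun j : Fin l => k + j.1)) R

lemma cut_rel (k l : ℕ) (col : ℕ → Color) (R : Setoid ℕ) (x y) :
    (cut k l col R).rel x y ↔ R (linePos (cut k l col R) x) (linePos (cut k l col R) y) := Iff.rfl

lemma cut_congr {k l : ℕ} {col : ℕ → Color} {R R' : Setoid ℕ}
    (h : ∀ x < k + l, ∀ y < k + l, R x y ↔ R' x y) : cut k l col R = cut k l col R' := by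
  unfold cut
  congr 1
  ext x y
  exact h _ (linePos_lt (cut k l col R) x) _ (linePos_lt (cut k l col R) y)

lemma exists_linePos_eq (p : TCP) {n : ℕ} (hn : n < p.k + p.l) : ∃ x, linePos p x = n := by
  by_cases h : n < p.k
  · exact ⟨.inl ⟨p.k - 1 - n, by omega⟩, by simp [linePos]; omega⟩
  · exact ⟨.inr ⟨n - p.k, by omega⟩, by simp [linePos]; omega⟩

/-- The blocks of `p` as an equivalence relation on line positions. -/
def lineRel (p : TCP) : Setoid ℕ where
  r m n := m = n ∨ ∃ x y, linePos p x = m ∧ linePos p y = n ∧ p.rel x y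
  iseqv := by
    refine ⟨fun _ => Or.inl rfl, ?_, ?_⟩
    · rintro m n (rfl | ⟨x, y, hx, hy, hxy⟩)
      · exact Or.inl rfl
      · exact Or.inr ⟨y, x, hy, hx, p.rel.symm hxy⟩
    · rintro m n o (rfl | ⟨x, y, hx, hy, hxy⟩) (rfl | ⟨x', y', hx', hy', hxy'⟩)
      · exact Or.inl rfl
      · exact Or.inr ⟨x', y', hx', hy', hxy'⟩
      · exact Or.inr ⟨x, y, hx, hy, hxy⟩
      · obtain rfl := linePos_injective p (hx'.trans hy.symm)
        exact Or.inr ⟨x, y', hx, hy', p.rel.trans hxy hxy'⟩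

lemma lineRel_linePos (p : TCP) (x y) : lineRel p (linePos p x) (linePos p y) ↔ p.rel x y := by
  constructor
  · rintro (h | ⟨x', y', hx, hy, hxy⟩)
    · rw [linePos_injective p h]
    · rwa [linePos_injective p hx, linePos_injective p hy] at hxy
  · exact fun h => Or.inr ⟨x, y, rfl, rfl, h⟩

/-- The colors of the points of `p` rotated to a line. -/
def lineCol (p : TCP) (n : ℕ) : Color :=
  if h : n < p.k then !(p.upColor ⟨p.k - 1 - n, by omega⟩)
  else if h' : n < p.k + p.l then p.lowColor ⟨n - p.k, by omega⟩ else white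

lemma eq_cut (p : TCP) : p = cut p.k p.l (lineCol p) (lineRel p) := by
  have hrel : p.rel = (cut p.k p.l (lineCol p) (lineRel p)).rel := by
    ext x y
    exact (lineRel_linePos p x y).symm
  have hup : p.upColor = (cut p.k p.l (lineCol p) (lineRel p)).upColor := by
    funext ⟨i, hi⟩
    have : p.k - 1 - (p.k - 1 - i) = i := by omega
    simp only [cut, lineCol]
    rw [dif_pos (by omega), Bool.not_not]
    simp only [this]
  have hlow : p.lowColor = (cut p.k p.l (lineCol p) (lineRel p)).lowColor := by
    funext ⟨i, hi⟩
    have : p.k + i - p.k = i := by omega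
    simp only [cut, lineCol]
    rw [dif_neg (by omega), dif_pos (by omega)]
    simp only [this]
  exact congr (congr (congrArg (TCP.mk p.k p.l) hup) hlow) hrel

lemma toLine_cut (k l : ℕ) (col : ℕ → Color) (R : Setoid ℕ) :
    toLine (cut k l col R) = cut 0 (k + l) col R := by
  have hpos : ∀ j : Fin (k + l), linePos (cut k l col R)
      (if hj : j.1 < k then Sum.inl ⟨k - 1 - j.1, by change _ < k; omega⟩
        else Sum.inr ⟨j.1 - k, by have := j.2; change _ < l; omega⟩) = 0 + j.1 := by
    intro j
    split_ifs with hj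
    · change k - 1 - (k - 1 - j.1) = _
      omega
    · change k + (j.1 - k) = _
      omega
  have hlow : (toLine (cut k l col R)).lowColor = (cut 0 (k + l) col R).lowColor := by
    funext j
    have hj := hpos j
    change (if hj : j.1 < k then !!(col (k - 1 - (k - 1 - j.1))) else col (k + (j.1 - k))) = col (0 + j.1)
    split_ifs with h
    · rw [Bool.not_not]
      congr 1
      omega
    · congr 1
      omega
  have hup : (toLine (cut k l col R)).upColor = (cut 0 (k + l) col R).upColor :=
    funext fun i => i.elim0
  have hrel : (toLine (cut k l col R)).rel = (cut 0 (k + l) col R).rel := by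
    ext x y
    rcases x with x | x
    · exact x.elim0
    rcases y with y | y
    · exact y.elim0
    exact iff_of_eq (congrArg₂ R (hpos x) (hpos y))
  exact congr (congr (congrArg (TCP.mk 0 (k + l)) hup) hlow) hrel

/-- The line version of `Good`. -/
structure GoodLine (n : ℕ) (col : ℕ → Color) (R : Setoid ℕ) : Prop where
  nc : ∀ a b x y, a < b → b < x → x < y → y < n → R a x → R b y → R a b
  even : ∀ χ : ℕ → ZMod 2, (∀ x < n, ∀ y < n, R x y → χ x = χ y) → ∑ i ∈ Finset.range n, χ i = 0
  tint_eq : ∀ x < n, ∀ y < n, R x y → hue (col x) + (x : ZMod 2) = hue (col y) + (y : ZMod 2)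

lemma sum_cut (k l : ℕ) (col : ℕ → Color) (R : Setoid ℕ) (χ : ℕ → ZMod 2) :
    ∑ x, χ (linePos (cut k l col R) x) = ∑ i ∈ Finset.range (k + l), χ i := by
  rw [Fintype.sum_sum_type, Finset.sum_range_add]
  change ∑ i : Fin k, χ (k - 1 - i.1) + ∑ j : Fin l, χ (k + j.1) = _
  rw [Fin.sum_univ_eq_sum_range (fun i => χ (k - 1 - i)) k, Finset.sum_range_reflect,
    Fin.sum_univ_eq_sum_range (fun j => χ (k + j)) l]

lemma tint_cut (k l : ℕ) (col : ℕ → Color) (R : Setoid ℕ) (x) :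
    tint (cut k l col R) x = hue (col (linePos (cut k l col R) x)) +
      (linePos (cut k l col R) x : ZMod 2) + k := by
  have h2 : (2 : ZMod 2) = 0 := rfl
  rcases x with ⟨i, hi⟩ | ⟨j, hj⟩
  · change i < k at hi
    change hue (!(col (k - 1 - i))) + (i : ZMod 2) = hue (col (k - 1 - i)) + ((k - 1 - i : ℕ) : ZMod 2) + k
    obtain ⟨m, rfl⟩ : ∃ m, k = m + i + 1 := ⟨k - 1 - i, by omega⟩
    have : m + i + 1 - 1 - i = m := by omega
    rw [this, hue_not]
    push_cast
    linear_combination -(m : ZMod 2) * h2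
  · change hue (col (k + j)) + (j : ZMod 2) = hue (col (k + j)) + ((k + j : ℕ) : ZMod 2) + k
    push_cast
    linear_combination -(k : ZMod 2) * h2

lemma Good.goodLine {k l : ℕ} {col : ℕ → Color} {R : Setoid ℕ} (h : Good (cut k l col R)) :
    GoodLine (k + l) col R where
  nc := by
    intro a b x y hab hbx hxy hy hax hby
    obtain ⟨a, rfl⟩ := exists_linePos_eq (cut k l col R) (n := a) (by change _ < k + l; omega)
    obtain ⟨b, rfl⟩ := exists_linePos_eq (cut k l col R) (n := b) (by change _ < k + l; omega)
    obtain ⟨x, rfl⟩ := exists_linePos_eq (cut k l col R) (n := x) (by change _ < k + l; omega)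
    obtain ⟨y, rfl⟩ := exists_linePos_eq (cut k l col R) (n := y) hy
    exact h.nc a b x y hab hbx hxy hax hby
  even := by
    intro χ hχ
    rw [← sum_cut k l col R]
    exact h.even _ (fun x y hxy => hχ _ (linePos_lt _ x) _ (linePos_lt _ y) hxy)
  tint_eq := by
    intro x hx y hy hxy
    obtain ⟨x, rfl⟩ := exists_linePos_eq (cut k l col R) hx
    obtain ⟨y, rfl⟩ := exists_linePos_eq (cut k l col R) hy
    have := h.tint_eq x y hxy
    rwa [tint_cut, tint_cut, add_left_inj] at this

lemma noncrossing_cut {k l : ℕ} {col : ℕ → Color} {R : Setoid ℕ} :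
    Noncrossing (cut k l col R) ↔
      ∀ a b x y, a < b → b < x → x < y → y < k + l → R a x → R b y → R a b := by
  constructor
  · intro h a b x y hab hbx hxy hy hax hby
    obtain ⟨a, rfl⟩ := exists_linePos_eq (cut k l col R) (n := a) (by change _ < k + l; omega)
    obtain ⟨b, rfl⟩ := exists_linePos_eq (cut k l col R) (n := b) (by change _ < k + l; omega)
    obtain ⟨x, rfl⟩ := exists_linePos_eq (cut k l col R) (n := x) (by change _ < k + l; omega)
    obtain ⟨y, rfl⟩ := exists_linePos_eq (cut k l col R) (n := y) hy
    exact h a b x y hab hbx hxy hax hby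
  · exact fun h a b x y hab hbx hxy hax hby => h _ _ _ _ hab hbx hxy (linePos_lt _ y) hax hby

/-! ### Even alternating blocks -/

/-- All blocks of `p` have even length and alternating colors. -/
def EvenAlternating (p : TCP) : Prop :=
  (∀ x : Fin p.k ⊕ Fin p.l, Even (blockSize p x)) ∧
    ∀ j j' : Fin p.l, p.rel.r (Sum.inr j) (Sum.inr j') → j.1 < j'.1 →
      (∀ m : Fin p.l, p.rel.r (Sum.inr j) (Sum.inr m) → ¬(j.1 < m.1 ∧ m.1 < j'.1)) →
      p.lowColor j' = !(p.lowColor j)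

lemma cut_zero_rel {n : ℕ} {col : ℕ → Color} {R : Setoid ℕ} (i j : Fin n) :
    (cut 0 n col R).rel (.inr i) (.inr j) ↔ R i.1 j.1 := by
  change R (0 + i.1) (0 + j.1) ↔ _
  rw [zero_add, zero_add]

lemma cut_zero_lowColor {n : ℕ} {col : ℕ → Color} {R : Setoid ℕ} (i : Fin n) :
    (cut 0 n col R).lowColor i = col i.1 := by
  change col (0 + i.1) = _
  rw [zero_add]

open Classical in
lemma blockSize_cut_zero {n : ℕ} {col : ℕ → Color} {R : Setoid ℕ} (i : Fin (cut 0 n col R).l) :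
    blockSize (cut 0 n col R) (.inr i) = ((Finset.range n).filter (R i.1)).card := by
  have hi : linePos (cut 0 n col R) (.inr i) = i.1 := zero_add _
  rw [blockSize, ← Fintype.card_coe, ← Nat.card_eq_fintype_card]
  refine Nat.card_eq_of_bijective (fun y => ⟨linePos (cut 0 n col R) y.1, ?_⟩) ⟨?_, ?_⟩
  · have h := (cut_rel 0 n col R _ _).1 y.2
    rw [hi] at h
    rw [Finset.mem_filter, Finset.mem_range]
    exact ⟨lt_of_lt_of_eq (linePos_lt _ _) (zero_add n), h⟩
  · intro y z hyz
    exact Subtype.ext (linePos_injective _ (congrArg Subtype.val hyz))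
  · rintro ⟨m, hm⟩
    rw [Finset.mem_filter, Finset.mem_range] at hm
    obtain ⟨y, rfl⟩ := exists_linePos_eq (cut 0 n col R) (lt_of_lt_of_eq hm.1 (zero_add n).symm)
    exact ⟨⟨y, (cut_rel 0 n col R _ _).2 (hi.symm ▸ hm.2)⟩, rfl⟩

/-- Consecutive points of a block are at odd distance. -/
lemma parity_of_consecutive {n : ℕ} {R : Setoid ℕ}
    (nc : ∀ a b x y, a < b → b < x → x < y → y < n → R a x → R b y → R a b)
    (even : ∀ χ : ℕ → ZMod 2, (∀ x < n, ∀ y < n, R x y → χ x = χ y) →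
      ∑ i ∈ Finset.range n, χ i = 0)
    {j j' : ℕ} (hj' : j' < n) (hR : R j j') (hlt : j < j')
    (hgap : ∀ m < n, R j m → ¬ (j < m ∧ m < j')) : (j' : ZMod 2) = j + 1 := by
  have hstep : ∀ x < n, ∀ y < n, R x y → j < x ∧ x < j' → j < y ∧ y < j' := by
    intro x hx y hy hxy hxj
    have hjx : ¬ R j x := fun h => hgap x hx h hxj
    by_contra hcon
    have h1 : y ≠ j := by
      rintro rfl
      exact hjx (R.symm hxy)
    have h2 : y ≠ j' := by
      rintro rfl
      exact hjx (R.trans hR (R.symm hxy))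
    rcases lt_or_ge y j with h | h
    · exact hjx (R.trans (R.symm (nc y j x j' h hxj.1 hxj.2 hj' (R.symm hxy) hR)) (R.symm hxy))
    · exact hjx (nc j x j' y hxj.1 hxj.2 (by omega) hy hR hxy)
  have h := even (fun i => if j < i ∧ i < j' then 1 else 0) (fun x hx y hy hxy => by
    have := hstep x hx y hy hxy
    have := hstep y hy x hx (R.symm hxy)
    split_ifs <;> tauto)
  rw [← Finset.sum_filter, Finset.sum_const, nsmul_eq_mul, mul_one] at h
  have hfil : (Finset.range n).filter (fun i => j < i ∧ i < j') = Finset.Ioo j j' := by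
    ext i
    simp only [Finset.mem_filter, Finset.mem_range, Finset.mem_Ioo]
    omega
  rw [hfil, Nat.card_Ioo] at h
  obtain ⟨m, rfl⟩ : ∃ m, j' = j + m + 1 := ⟨j' - j - 1, by omega⟩
  have : j + m + 1 - j - 1 = m := by omega
  rw [this] at h
  push_cast
  rw [h, add_zero]

open Classical in
lemma GoodLine.evenAlternating {n : ℕ} {col : ℕ → Color} {R : Setoid ℕ} (h : GoodLine n col R) :
    EvenAlternating (cut 0 n col R) := by
  refine ⟨?_, ?_⟩
  · rintro (i | i)
    · exact i.elim0
    · rw [blockSize_cut_zero, even_iff_two_dvd, ← ZMod.natCast_eq_zero_iff]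
      have := h.even (fun j => if R i.1 j then 1 else 0) (fun x _ y _ hxy => by
        have : R i.1 x ↔ R i.1 y := ⟨fun h => R.trans h hxy, fun h => R.trans h (R.symm hxy)⟩
        simp only [this])
      rwa [← Finset.sum_filter, Finset.sum_const, nsmul_eq_mul, mul_one] at this
  · intro j j' hjj hlt hgap
    have hR : R j.1 j'.1 := (cut_zero_rel j j').1 hjj
    have hpar := parity_of_consecutive h.nc h.even j'.2 hR hlt
      (fun m hm hRm => hgap ⟨m, hm⟩ ((cut_zero_rel j ⟨m, hm⟩).2 hRm))
    have ht := h.tint_eq _ j.2 _ j'.2 hR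
    refine (cut_zero_lowColor j').trans (Eq.trans ?_ (congrArg _ (cut_zero_lowColor j).symm))
    apply hue_injective
    rw [hue_not]
    have h2 : (2 : ZMod 2) = 0 := rfl
    rw [hpar] at ht
    linear_combination (-1 : ZMod 2) * ht - h2

open Classical in
lemma goodLine_of_evenAlternating {n : ℕ} {col : ℕ → Color} {R : Setoid ℕ}
    (nc : ∀ a b x y, a < b → b < x → x < y → y < n → R a x → R b y → R a b)
    (h : EvenAlternating (cut 0 n col R)) : GoodLine n col R := by
  have even : ∀ χ : ℕ → ZMod 2, (∀ x < n, ∀ y < n, R x y → χ x = χ y) →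
      ∑ i ∈ Finset.range n, χ i = 0 := by
    intro χ hχ
    rw [Finset.sum_partition R]
    refine Finset.sum_eq_zero fun c hc => ?_
    obtain ⟨i, hi, rfl⟩ := Finset.mem_image.1 hc
    rw [Finset.mem_range] at hi
    have hfil : (Finset.range n).filter (fun y => (⟦y⟧ : Quotient R) = ⟦i⟧) =
        (Finset.range n).filter (R i) := by
      refine Finset.filter_congr fun y _ => ?_
      rw [Quotient.eq]
      exact ⟨fun h => R.symm h, fun h => R.symm h⟩
    rw [hfil, Finset.sum_congr rfl (g := fun _ => χ i), Finset.sum_const, nsmul_eq_mul]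
    · have := h.1 (.inr ⟨i, hi⟩)
      rw [blockSize_cut_zero, even_iff_two_dvd, ← ZMod.natCast_eq_zero_iff] at this
      rw [this, zero_mul]
    · intro y hy
      rw [Finset.mem_filter, Finset.mem_range] at hy
      exact (hχ _ hi _ hy.1 hy.2).symm
  have key : ∀ d x y, y - x = d → x < y → y < n → R x y →
      hue (col x) + (x : ZMod 2) = hue (col y) + (y : ZMod 2) := by
    intro d
    induction d using Nat.strong_induction_on with
    | _ d ih =>
      intro x y hd hxy hy hR
      by_cases hm : ∃ m, R x m ∧ x < m ∧ m < y
      · obtain ⟨m, hRm, h1, h2⟩ := hm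
        exact (ih (m - x) (by omega) x m rfl h1 (by omega) hRm).trans
          (ih (y - m) (by omega) m y rfl h2 hy (R.trans (R.symm hRm) hR))
      · have hpar := parity_of_consecutive nc even hy hR hxy
          (fun m _ hRm hlt => hm ⟨m, hRm, hlt⟩)
        have hcol := h.2 ⟨x, by change x < n; omega⟩ ⟨y, hy⟩ ((cut_zero_rel _ _).2 hR) hxy
          (fun m hRm hlt => hm ⟨m.1, (cut_zero_rel ⟨x, _⟩ m).1 hRm, hlt⟩)
        have hcol' : col y = !(col x) :=
          (cut_zero_lowColor ⟨y, hy⟩).symm.trans (hcol.trans (congrArg _ (cut_zero_lowColor _)))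
        have h2 : (2 : ZMod 2) = 0 := rfl
        rw [hcol', hue_not, hpar]
        linear_combination -h2
  refine ⟨nc, even, fun x hx y hy hR => ?_⟩
  rcases lt_trichotomy x y with hlt | rfl | hlt
  · exact key _ x y rfl hlt hy hR
  · rfl
  · exact (key _ y x rfl hlt hx (R.symm hR)).symm

/-! ### Partitions drawn with numerical labels -/

/-- The partition whose points carry the labels `f` and `g`, with blocks given by the relation
`R` on labels. -/
def draw (k l : ℕ) (u d : ℕ → Color) (f g : ℕ → ℕ) (R : Setoid ℕ) : TCP where
  k := k
  l := l
  upColor := fun i => u i.1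
  lowColor := fun j => d j.1
  rel := Setoid.comap (Sum.elim (fun i : Fin k => f i.1) (fun j : Fin l => g j.1)) R

lemma cut_eq_draw (k l : ℕ) (col : ℕ → Color) (R : Setoid ℕ) :
    cut k l col R =
      draw k l (fun i => !(col (k - 1 - i))) (fun j => col (k + j)) (k - 1 - ·) (k + ·) R := rfl

lemma draw_eq_tensor {p q : TCP} {k l : ℕ} {u d : ℕ → Color} {f g : ℕ → ℕ} {R : Setoid ℕ}
    (hk : k = p.k + q.k) (hl : l = p.l + q.l)
    (hup : ∀ i : Fin p.k, u i = p.upColor i) (huq : ∀ i : Fin q.k, u (p.k + i) = q.upColor i)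
    (hdp : ∀ j : Fin p.l, d j = p.lowColor j) (hdq : ∀ j : Fin q.l, d (p.l + j) = q.lowColor j)
    (hp : ∀ x y : Fin p.k ⊕ Fin p.l, R (Sum.elim (fun i => f i.1) (fun j => g j.1) x)
      (Sum.elim (fun i => f i.1) (fun j => g j.1) y) ↔ p.rel x y)
    (hq : ∀ x y : Fin q.k ⊕ Fin q.l,
      R (Sum.elim (fun i => f (p.k + i.1)) (fun j => g (p.l + j.1)) x)
        (Sum.elim (fun i => f (p.k + i.1)) (fun j => g (p.l + j.1)) y) ↔ q.rel x y)
    (hpq : ∀ (x : Fin p.k ⊕ Fin p.l) (y : Fin q.k ⊕ Fin q.l),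
      ¬ R (Sum.elim (fun i => f i.1) (fun j => g j.1) x)
        (Sum.elim (fun i => f (p.k + i.1)) (fun j => g (p.l + j.1)) y)) :
    draw k l u d f g R = tensor p q := by
  subst hk hl
  have hU : (draw (p.k + q.k) (p.l + q.l) u d f g R).upColor = (tensor p q).upColor := by
    funext i
    change u i.1 = (finSumFinEquiv.symm i).elim p.upColor q.upColor
    refine Fin.addCases (fun i => ?_) (fun i => ?_) i
    · simpa using hup i
    · simpa using huq i
  have hD : (draw (p.k + q.k) (p.l + q.l) u d f g R).lowColor = (tensor p q).lowColor := by
    funext i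
    change d i.1 = (finSumFinEquiv.symm i).elim p.lowColor q.lowColor
    refine Fin.addCases (fun i => ?_) (fun i => ?_) i
    · simpa using hdp i
    · simpa using hdq i
  have hL : ∀ x, Sum.elim (fun i : Fin (tensor p q).k => f i.1)
      (fun j : Fin (tensor p q).l => g j.1) (embL p q x) =
      Sum.elim (fun i => f i.1) (fun j => g j.1) x := by rintro (x | x) <;> rfl
  have hR : ∀ x, Sum.elim (fun i : Fin (tensor p q).k => f i.1)
      (fun j : Fin (tensor p q).l => g j.1) (embR p q x) =
      Sum.elim (fun i => f (p.k + i.1)) (fun j => g (p.l + j.1)) x := by rintro (x | x) <;> rfl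
  have hrel : (draw (p.k + q.k) (p.l + q.l) u d f g R).rel = (tensor p q).rel := by
    ext x y
    change R (Sum.elim (fun i : Fin (tensor p q).k => f i.1)
      (fun j : Fin (tensor p q).l => g j.1) x) (Sum.elim (fun i : Fin (tensor p q).k => f i.1)
      (fun j : Fin (tensor p q).l => g j.1) y) ↔ (tensor p q).rel x y
    rcases tensor_cases p q x with ⟨x, rfl⟩ | ⟨x, rfl⟩ <;>
      rcases tensor_cases p q y with ⟨y, rfl⟩ | ⟨y, rfl⟩
    · rw [hL, hL, tensor_rel_LL, hp]
    · rw [hL, hR]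
      exact iff_of_false (hpq x y) (tensor_rel_LR p q x y)
    · rw [hL, hR]
      exact iff_of_false (fun h => hpq y x (R.symm h)) (tensor_rel_RL p q x y)
    · rw [hR, hR, tensor_rel_RR, hq]
  exact congr (congr (congrArg (TCP.mk (p.k + q.k) (p.l + q.l)) hU) hD) hrel

lemma draw_eq_comp {q p : TCP} (h : q.l = p.k) {k l : ℕ} {u d : ℕ → Color} {f g : ℕ → ℕ}
    {R : Setoid ℕ} (m : ℕ → ℕ) (hk : k = q.k) (hl : l = p.l)
    (hu : ∀ i : Fin q.k, u i = q.upColor i) (hd : ∀ j : Fin p.l, d j = p.lowColor j)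
    (hq : ∀ x y, q.rel x y → R (Sum.elim (fun i => f i.1) (fun j => m j.1) x)
      (Sum.elim (fun i => f i.1) (fun j => m j.1) y))
    (hp : ∀ x y, p.rel x y → R (Sum.elim (fun i => m i.1) (fun j => g j.1) x)
      (Sum.elim (fun i => m i.1) (fun j => g j.1) y))
    (hR : ∀ s t : (Fin q.k ⊕ Fin q.l) ⊕ Fin p.l,
      R (Sum.elim (Sum.elim (fun i => f i.1) (fun j => m j.1)) (fun j => g j.1) s)
        (Sum.elim (Sum.elim (fun i => f i.1) (fun j => m j.1)) (fun j => g j.1) t) →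
      compSetoid q p h s t) :
    draw k l u d f g R = comp q p h := by
  subst hk hl
  have hU : (draw q.k p.l u d f g R).upColor = (comp q p h).upColor := funext hu
  have hD : (draw q.k p.l u d f g R).lowColor = (comp q p h).lowColor := funext hd
  have hrel : (draw q.k p.l u d f g R).rel = (comp q p h).rel := by
    let G : (Fin q.k ⊕ Fin q.l) ⊕ Fin p.l → ℕ :=
      Sum.elim (Sum.elim (fun i => f i.1) (fun j => m j.1)) (fun j => g j.1)
    have hG : ∀ x, (Sum.elim (fun i => f i.1) (fun j => g j.1) : Fin q.k ⊕ Fin p.l → ℕ) x =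
        G (compOuter q p h x) := by
      rintro (x | x) <;> rfl
    have hM : ∀ x, G (compEmbMid q p h x) = Sum.elim (fun i => m i.1) (fun j => g j.1) x := by
      rintro (x | x) <;> rfl
    have hiff : ∀ x y : Fin q.k ⊕ Fin p.l, R (Sum.elim (fun i => f i.1) (fun j => g j.1) x)
        (Sum.elim (fun i => f i.1) (fun j => g j.1) y) ↔
        compSetoid q p h (compOuter q p h x) (compOuter q p h y) := by
      intro x y
      rw [hG, hG]
      refine ⟨hR _ _, compSetoid_le q p h (R.comap G) hq fun x y hxy => ?_⟩
      change R (G _) (G _)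
      rw [hM, hM]
      exact hp x y hxy
    ext x y
    exact hiff x y
  exact congr (congr (congrArg (TCP.mk q.k p.l) hU) hD) hrel

/-! ### Constructions inside a category -/

section Category

variable {C : Set TCP}

lemma IsCategory.idPart_mem (hC : IsCategory C) (c : Color) : idPart c ∈ C := by
  cases c
  exacts [hC.idb_mem, hC.idw_mem]

lemma IsCategory.pairLower_mem (hC : IsCategory C) {c c' : Color} (h : c' = !c) :
    pairLower c c' ∈ C := by
  subst h
  cases c
  exacts [hC.pairbw_mem, hC.pairwb_mem]

lemma IsCategory.draw_zero_mem (hC : IsCategory C) (u d : ℕ → Color) (f g : ℕ → ℕ)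
    (R : Setoid ℕ) : draw 0 0 u d f g R ∈ C := by
  have hp := hC.pairwb_mem
  have : draw 0 0 u d f g R = comp (pairLower white black) (invol (pairLower white black)) rfl := by
    refine congr (congr (congrArg (TCP.mk 0 0) ?_) ?_) ?_
    · exact funext fun i => i.elim0
    · exact funext fun i => i.elim0
    · ext (x | x) <;> exact x.elim0
  rw [this]
  exact hC.comp_mem _ hp _ (hC.invol_mem _ hp) rfl fun _ => rfl

/-- The identity on a row of `n` points. -/
def idRow (n : ℕ) (d : ℕ → Color) : TCP := draw n n d d id id ⊥

lemma IsCategory.idRow_mem (hC : IsCategory C) (n : ℕ) (d : ℕ → Color) : idRow n d ∈ C := by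
  induction n with
  | zero => exact hC.draw_zero_mem _ _ _ _ _
  | succ n ih =>
    have : idRow (n + 1) d = tensor (idRow n d) (idPart (d n)) := by
      refine draw_eq_tensor rfl rfl (fun _ => rfl) ?_ (fun _ => rfl) ?_ (fun _ _ => Iff.rfl) ?_ ?_
      · rintro ⟨i, hi⟩
        obtain rfl : i = 0 := Nat.lt_one_iff.1 hi
        rfl
      · rintro ⟨i, hi⟩
        obtain rfl : i = 0 := Nat.lt_one_iff.1 hi
        rfl
      · rintro (⟨i, hi⟩ | ⟨i, hi⟩) (⟨j, hj⟩ | ⟨j, hj⟩) <;>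
        · obtain rfl : i = 0 := Nat.lt_one_iff.1 hi
          obtain rfl : j = 0 := Nat.lt_one_iff.1 hj
          exact iff_of_true rfl trivial
      · rintro (⟨i, hi⟩ | ⟨i, hi⟩) (⟨j, hj⟩ | ⟨j, hj⟩) <;>
        · change ¬ i = n + j
          change i < n at hi
          omega
    rw [this]
    exact hC.tensor_mem _ ih _ (hC.idPart_mem _)

/-- The colors `c`, `!c` followed by the colors `d`. -/
def capColor (c : Color) (d : ℕ → Color) : ℕ → Color
  | 0 => c
  | 1 => !c
  | j + 2 => d j

/-- A pair of upper points to the left of the identity on a row of `b` points. -/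
def capRow (b : ℕ) (c : Color) (d : ℕ → Color) : TCP :=
  draw (b + 2) b (capColor c d) d (· - 1) (· + 1) ⊥

lemma IsCategory.capRow_mem (hC : IsCategory C) (b : ℕ) (c : Color) (d : ℕ → Color) :
    capRow b c d ∈ C := by
  have : capRow b c d = tensor (invol (pairLower c (!c))) (idRow b d) := by
    refine draw_eq_tensor (add_comm b 2) (zero_add b).symm ?_ ?_ (fun j => j.elim0) ?_ ?_ ?_ ?_
    · intro i
      change Fin 2 at i
      fin_cases i <;> rfl
    · rintro ⟨i, hi⟩
      change capColor c d (2 + i) = d i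
      rw [add_comm]
      rfl
    · rintro ⟨i, hi⟩
      change d (0 + i) = d i
      rw [zero_add]
    · rintro (i | i) (j | j)
      · change Fin 2 at i j
        refine iff_of_true ?_ rfl
        change i.1 - 1 = j.1 - 1
        omega
      · exact j.elim0
      · exact i.elim0
      · exact j.elim0
    · rintro (⟨i, hi⟩ | ⟨i, hi⟩) (⟨j, hj⟩ | ⟨j, hj⟩)
      · change 2 + i - 1 = 2 + j - 1 ↔ i = j
        omega
      · change 2 + i - 1 = 0 + j + 1 ↔ i = j
        omega
      · change 0 + i + 1 = 2 + j - 1 ↔ i = j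
        omega
      · change 0 + i + 1 = 0 + j + 1 ↔ i = j
        omega
    · rintro (⟨i, hi⟩ | i) (⟨j, hj⟩ | ⟨j, hj⟩)
      · change ¬ i - 1 = 2 + j - 1
        change i < 2 at hi
        omega
      · change ¬ i - 1 = 0 + j + 1
        change i < 2 at hi
        omega
      · exact i.elim0
      · exact i.elim0
  rw [this]
  exact hC.tensor_mem _ (hC.invol_mem _ (hC.pairLower_mem rfl)) _ (hC.idRow_mem _ _)

lemma IsCategory.cut_up (hC : IsCategory C) {a b : ℕ} {col : ℕ → Color} {R : Setoid ℕ}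
    (h : cut a (b + 1) col R ∈ C) : cut (a + 1) b col R ∈ C := by
  let r := cut a (b + 1) col R
  let q := tensor (idPart (!(col a))) r
  let p := capRow b (!(col a)) (fun j => col (a + 1 + j))
  have hqp : q.l = p.k := add_comm 1 (b + 1)
  have hmatch : ColorsMatch q p hqp := by
    refine Fin.addCases (fun j => ?_) (fun j => ?_)
    · change Fin 1 at j
      obtain rfl := Subsingleton.elim j 0
      rfl
    · obtain ⟨j, hj⟩ := j
      simp only [q, p, tensor, finSumFinEquiv_symm_apply_natAdd, Sum.elim_inr]
      rcases j with _ | j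
      · change col a = !!(col a)
        rw [Bool.not_not]
      · change col (a + (j + 1)) = capColor _ _ (1 + (j + 1))
        rw [show 1 + (j + 1) = j + 2 by omega]
        change _ = col (a + 1 + j)
        congr 1
        omega
  have hcomp : cut (a + 1) b col R = comp q p hqp := by
    rw [cut_eq_draw]
    have hlab : ∀ z, Sum.elim (fun i : Fin q.k => a + 1 - 1 - i.1) (fun j : Fin q.l => a + (j.1 - 1))
        (embR (idPart (!(col a))) r z) = linePos r z := by
      rintro (⟨i, hi⟩ | ⟨j, hj⟩)
      · change a + 1 - 1 - (1 + i) = a - 1 - i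
        omega
      · change a + (1 + j - 1) = a + j
        omega
    have hlabL : ∀ z, Sum.elim (fun i : Fin q.k => a + 1 - 1 - i.1)
        (fun j : Fin q.l => a + (j.1 - 1)) (embL (idPart (!(col a))) r z) = a := by
      rintro (⟨i, hi⟩ | ⟨j, hj⟩)
      · change a + 1 - 1 - i = a
        change i < 1 at hi
        omega
      · change a + (j - 1) = a
        change j < 1 at hj
        omega
    refine draw_eq_comp hqp (fun j => a + (j - 1)) (add_comm a 1) rfl ?_ (fun _ => rfl) ?_ ?_ ?_
    · refine Fin.addCases (fun j => ?_) (fun j => ?_)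
      · change Fin 1 at j
        obtain rfl := Subsingleton.elim j 0
        simp [q, tensor, idPart]
      · obtain ⟨j, hj⟩ := j
        simp only [q, tensor, finSumFinEquiv_symm_apply_natAdd, Sum.elim_inr]
        change (!(col (a + 1 - 1 - (1 + j)))) = !(col (a - 1 - j))
        congr 2
        omega
    · intro x y hxy
      rcases tensor_cases _ _ x with ⟨x, rfl⟩ | ⟨x, rfl⟩ <;>
        rcases tensor_cases _ _ y with ⟨y, rfl⟩ | ⟨y, rfl⟩
      · rw [hlabL, hlabL]
      · exact absurd hxy (tensor_rel_LR _ _ _ _)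
      · exact absurd hxy (tensor_rel_RL _ _ _ _)
      · rw [hlab, hlab]
        exact (tensor_rel_RR _ _ _ _).1 hxy
    · rintro (⟨x, hx⟩ | ⟨x, hx⟩) (⟨y, hy⟩ | ⟨y, hy⟩) hxy
      · change R (a + (x - 1)) (a + (y - 1))
        change x - 1 = y - 1 at hxy
        rw [hxy]
      · change R (a + (x - 1)) (a + 1 + y)
        change x - 1 = y + 1 at hxy
        rw [hxy, add_assoc, add_comm 1 y]
      · change R (a + 1 + x) (a + (y - 1))
        change x + 1 = y - 1 at hxy
        rw [← hxy, add_assoc, add_comm 1 x]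
      · change R (a + 1 + x) (a + 1 + y)
        change x + 1 = y + 1 at hxy
        rw [Nat.add_right_cancel hxy]
    · let G : (Fin q.k ⊕ Fin q.l) ⊕ Fin p.l → ℕ := Sum.elim (Sum.elim (fun i => a + 1 - 1 - i.1)
        (fun j => a + (j.1 - 1))) (fun j => a + 1 + j.1)
      have hrep : ∀ t, ∃ z, G t = linePos r z ∧
          compSetoid q p hqp t (.inl (embR (idPart (!(col a))) r z)) := by
        rintro (t | ⟨j, hj⟩)
        · rcases tensor_cases _ _ t with ⟨x, rfl⟩ | ⟨x, rfl⟩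
          · refine ⟨.inr ⟨0, Nat.succ_pos b⟩, hlabL x, ?_⟩
            refine Setoid.trans' _ (compSetoid_left q p hqp (y := embL _ _ (.inr ⟨0, Nat.one_pos⟩))
              ((tensor_rel_LL _ _ _ _).2 trivial)) ?_
            exact compSetoid_right q p hqp (x := .inl ⟨0, Nat.succ_pos _⟩)
              (y := .inl ⟨1, Nat.succ_lt_succ (Nat.succ_pos _)⟩) rfl
          · exact ⟨x, hlab x, Setoid.refl' _ _⟩
        · refine ⟨.inr ⟨j + 1, Nat.succ_lt_succ hj⟩, ?_, ?_⟩
          · change a + 1 + j = a + (j + 1)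
            omega
          · have := compSetoid_right q p hqp (x := .inr ⟨j, hj⟩)
              (y := .inl ⟨1 + (j + 1), by change _ < b + 2; change j < b at hj; omega⟩)
              (by change j + 1 = 1 + (j + 1) - 1; omega)
            exact this
      intro s t hst
      obtain ⟨x, hx, hsx⟩ := hrep s
      obtain ⟨y, hy, hty⟩ := hrep t
      change R (G s) (G t) at hst
      rw [hx, hy] at hst
      exact Setoid.trans' _ hsx (Setoid.trans' _ (compSetoid_left q p hqp
        ((tensor_rel_RR _ _ _ _).2 hst)) (Setoid.symm' _ hty))
  rw [hcomp]
  exact hC.comp_mem _ (hC.tensor_mem _ (hC.idPart_mem _) _ h) _ (hC.capRow_mem _ _ _) _ hmatch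

lemma IsCategory.cut_down (hC : IsCategory C) {a b : ℕ} {col : ℕ → Color} {R : Setoid ℕ}
    (h : cut (a + 1) b col R ∈ C) : cut a (b + 1) col R ∈ C := by
  let r := cut (a + 1) b col R
  let q := invol (capRow a (col a) (fun i => !(col (a - 1 - i))))
  let p := tensor (idPart (col a)) r
  have hqp : q.l = p.k := add_comm (a + 1) 1
  have hmatch : ColorsMatch q p hqp := by
    suffices ∀ j : Fin p.k, q.lowColor (Fin.cast hqp.symm j) = p.upColor j from
      fun j => this (Fin.cast hqp j)
    refine Fin.addCases (fun j => ?_) (fun j => ?_)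
    · change Fin 1 at j
      obtain rfl := Subsingleton.elim j 0
      rfl
    · obtain ⟨j, hj⟩ := j
      simp only [p, tensor, finSumFinEquiv_symm_apply_natAdd, Sum.elim_inr]
      rcases j with _ | j
      · rfl
      · change capColor _ _ (1 + (j + 1)) = !(col (a + 1 - 1 - (j + 1)))
        rw [show 1 + (j + 1) = j + 2 by omega]
        change (!(col (a - 1 - j))) = _
        congr 2
        omega
  have hcomp : cut a (b + 1) col R = comp q p hqp := by
    rw [cut_eq_draw]
    have hlab : ∀ z, Sum.elim (fun i : Fin p.k => a - (i.1 - 1)) (fun j : Fin p.l => a + j.1)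
        (embR (idPart (col a)) r z) = linePos r z := by
      rintro (⟨i, hi⟩ | ⟨j, hj⟩)
      · change a - (1 + i - 1) = a + 1 - 1 - i
        omega
      · change a + (1 + j) = a + 1 + j
        omega
    have hlabL : ∀ z, Sum.elim (fun i : Fin p.k => a - (i.1 - 1)) (fun j : Fin p.l => a + j.1)
        (embL (idPart (col a)) r z) = a := by
      rintro (⟨i, hi⟩ | ⟨j, hj⟩)
      · change a - (i - 1) = a
        change i < 1 at hi
        omega
      · change a + j = a
        change j < 1 at hj
        omega
    refine draw_eq_comp hqp (fun j => a - (j - 1)) rfl (add_comm b 1) (fun _ => rfl) ?_ ?_ ?_ ?_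
    · refine Fin.addCases (fun j => ?_) (fun j => ?_)
      · change Fin 1 at j
        obtain rfl := Subsingleton.elim j 0
        simp [p, tensor, idPart]
      · obtain ⟨j, hj⟩ := j
        simp only [p, tensor, finSumFinEquiv_symm_apply_natAdd, Sum.elim_inr]
        change col (a + (1 + j)) = col (a + 1 + j)
        rw [add_assoc]
    · rintro (⟨x, hx⟩ | ⟨x, hx⟩) (⟨y, hy⟩ | ⟨y, hy⟩) hxy
      · change R (a - 1 - x) (a - 1 - y)
        change x + 1 = y + 1 at hxy
        rw [Nat.add_right_cancel hxy]
      · change R (a - 1 - x) (a - (y - 1))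
        change x + 1 = y - 1 at hxy
        rw [← hxy, Nat.sub_sub, add_comm 1 x]
      · change R (a - (x - 1)) (a - 1 - y)
        change x - 1 = y + 1 at hxy
        rw [hxy, Nat.sub_sub, add_comm 1 y]
      · change R (a - (x - 1)) (a - (y - 1))
        change x - 1 = y - 1 at hxy
        rw [hxy]
    · intro x y hxy
      rcases tensor_cases _ _ x with ⟨x, rfl⟩ | ⟨x, rfl⟩ <;>
        rcases tensor_cases _ _ y with ⟨y, rfl⟩ | ⟨y, rfl⟩
      · rw [hlabL, hlabL]
      · exact absurd hxy (tensor_rel_LR _ _ _ _)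
      · exact absurd hxy (tensor_rel_RL _ _ _ _)
      · rw [hlab, hlab]
        exact (tensor_rel_RR _ _ _ _).1 hxy
    · let G : (Fin q.k ⊕ Fin q.l) ⊕ Fin p.l → ℕ := Sum.elim (Sum.elim (fun i => a - 1 - i.1)
        (fun j => a - (j.1 - 1))) (fun j => a + j.1)
      have hG : ∀ x, G (compEmbMid q p hqp x) = Sum.elim (fun i : Fin p.k => a - (i.1 - 1))
          (fun j : Fin p.l => a + j.1) x := by rintro (x | x) <;> rfl
      have hmid : ∀ x, ∃ z, G (compEmbMid q p hqp x) = linePos r z ∧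
          compSetoid q p hqp (compEmbMid q p hqp x)
            (compEmbMid q p hqp (embR (idPart (col a)) r z)) := by
        intro x
        rcases tensor_cases _ _ x with ⟨x, rfl⟩ | ⟨x, rfl⟩
        · refine ⟨.inl ⟨0, Nat.succ_pos a⟩, (hG _).trans (hlabL x), ?_⟩
          refine Setoid.trans' _ (compSetoid_right q p hqp (y := embL _ _ (.inl ⟨0, Nat.one_pos⟩))
            ((tensor_rel_LL _ _ _ _).2 trivial)) ?_
          exact compSetoid_left q p hqp (x := .inr ⟨0, Nat.succ_pos _⟩)
            (y := .inr ⟨1, Nat.succ_lt_succ (Nat.succ_pos _)⟩) rfl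
        · exact ⟨x, (hG _).trans (hlab x), Setoid.refl' _ _⟩
      have hrep : ∀ t, ∃ z, G t = linePos r z ∧
          compSetoid q p hqp t (compEmbMid q p hqp (embR (idPart (col a)) r z)) := by
        rintro ((⟨i, hi⟩ | j) | j)
        · refine ⟨.inl ⟨i + 1, Nat.succ_lt_succ hi⟩, ?_, ?_⟩
          · change a - 1 - i = a + 1 - 1 - (i + 1)
            omega
          · have := compSetoid_left q p hqp (x := .inl ⟨i, hi⟩)
              (y := .inr ⟨1 + (i + 1), by change _ < a + 2; change i < a at hi; omega⟩)
              (by change i + 1 = 1 + (i + 1) - 1; omega)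
            exact this
        · exact hmid (.inl (Fin.cast hqp j))
        · exact hmid (.inr j)
      intro s t hst
      obtain ⟨x, hx, hsx⟩ := hrep s
      obtain ⟨y, hy, hty⟩ := hrep t
      change R (G s) (G t) at hst
      rw [hx, hy] at hst
      exact Setoid.trans' _ hsx (Setoid.trans' _ (compSetoid_right q p hqp
        ((tensor_rel_RR _ _ _ _).2 hst)) (Setoid.symm' _ hty))
  rw [hcomp]
  exact hC.comp_mem _ (hC.invol_mem _ (hC.capRow_mem _ _ _)) _
    (hC.tensor_mem _ (hC.idPart_mem _) _ h) _ hmatch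

/-- Membership in a category only depends on the line, not on where it is cut. -/
lemma IsCategory.cut_mem_iff (hC : IsCategory C) (a b : ℕ) {col : ℕ → Color} {R : Setoid ℕ} :
    cut a b col R ∈ C ↔ cut 0 (a + b) col R ∈ C := by
  induction a generalizing b with
  | zero => rw [zero_add]
  | succ a ih =>
    rw [show a + 1 + b = a + (b + 1) by omega, ← ih]
    exact ⟨hC.cut_down, hC.cut_up⟩

lemma IsCategory.cut_zero_mem (hC : IsCategory C) (col : ℕ → Color) (R : Setoid ℕ) :
    cut 0 0 col R ∈ C := by
  rw [cut_eq_draw]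
  exact hC.draw_zero_mem _ _ _ _ _

/-- A block of two upper and two lower points to the left of the identity on `b` points. -/
def mergeRow (b : ℕ) (c : Color) (d : ℕ → Color) : TCP :=
  draw (b + 2) (b + 2) (capColor c d) (capColor c d) (· - 1) (· - 1) ⊥

lemma mergeRow_eq_tensor (b : ℕ) (c : Color) (d : ℕ → Color) :
    mergeRow b c d = tensor (mergeRow 0 c d) (idRow b d) := by
  have hcol : ∀ i, capColor c d (2 + i) = d i := fun i => by
    rw [add_comm]
    rfl
  refine draw_eq_tensor (add_comm b 2) (add_comm b 2) (fun _ => rfl) (fun i => hcol i.1)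
    (fun _ => rfl) (fun i => hcol i.1) (fun _ _ => Iff.rfl) ?_ ?_
  · rintro (⟨i, hi⟩ | ⟨i, hi⟩) (⟨j, hj⟩ | ⟨j, hj⟩) <;>
    · change 2 + i - 1 = 2 + j - 1 ↔ i = j
      omega
  · rintro (⟨i, hi⟩ | ⟨i, hi⟩) (⟨j, hj⟩ | ⟨j, hj⟩) <;>
    · change ¬ i - 1 = 2 + j - 1
      change i < 2 at hi
      omega

lemma IsCategory.glue_mem (hC : IsCategory C) {a b : ℕ} {col : ℕ → Color} {R : Setoid ℕ}
    (hM : mergeRow 0 (col a) (fun j => col (a + 2 + j)) ∈ C) (hcol : col (a + 1) = !(col a))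
    (h : cut a (b + 2) col R ∈ C) : cut a (b + 2) col (glue R a (a + 1)) ∈ C := by
  let q := cut a (b + 2) col R
  let p := mergeRow b (col a) (fun j => col (a + 2 + j))
  have hp : p ∈ C := by
    change mergeRow b (col a) (fun j => col (a + 2 + j)) ∈ C
    rw [mergeRow_eq_tensor]
    exact hC.tensor_mem _ hM _ (hC.idRow_mem _ _)
  have hcap : ∀ j, col (a + j) = capColor (col a) (fun j => col (a + 2 + j)) j := by
    rintro (_ | _ | j)
    · rfl
    · exact hcol
    · change _ = col (a + 2 + j)
      congr 1
      omega
  have hcomp : cut a (b + 2) col (glue R a (a + 1)) = comp q p rfl := by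
    rw [cut_eq_draw]
    refine draw_eq_comp rfl (fun j => a + j) rfl rfl (fun _ => rfl) (fun j => hcap j.1)
      (fun x y hxy => Or.inl hxy) ?_ ?_
    · have key : ∀ i j, i - 1 = j - 1 → glue R a (a + 1) (a + i) (a + j) := by
        rintro (_ | _ | i) (_ | _ | j) hij
        · exact Or.inl (R.refl _)
        · exact Or.inr (Or.inl ⟨R.refl _, R.refl _⟩)
        · omega
        · exact Or.inr (Or.inr ⟨R.refl _, R.refl _⟩)
        · exact Or.inl (R.refl _)
        · omega
        · omega
        · omega
        · obtain rfl : i = j := by omega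
          exact Or.inl (R.refl _)
      rintro (i | i) (j | j) hij <;> exact key i.1 j.1 hij
    · let G : (Fin q.k ⊕ Fin q.l) ⊕ Fin p.l → ℕ := Sum.elim (Sum.elim (fun i => a - 1 - i.1)
        (fun j => a + j.1)) (fun j => a + j.1)
      have hrep : ∀ t, ∃ z, G t = linePos q z ∧ compSetoid q p rfl t (.inl z) := by
        rintro (z | j)
        · refine ⟨z, ?_, Setoid.refl' _ _⟩
          rcases z with z | z <;> rfl
        · exact ⟨.inr j, rfl, compSetoid_right q p rfl (x := .inr j) (y := .inl j) rfl⟩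
      have h0 : 0 < b + 2 := by omega
      have h1 : 1 < b + 2 := by omega
      have hjoin : compSetoid q p rfl (.inl (.inr ⟨0, h0⟩)) (.inl (.inr ⟨1, h1⟩)) :=
        compSetoid_right q p rfl (x := .inl ⟨0, h0⟩) (y := .inl ⟨1, h1⟩) rfl
      intro s t hst
      obtain ⟨x, hx, hsx⟩ := hrep s
      obtain ⟨y, hy, hty⟩ := hrep t
      change glue R a (a + 1) (G s) (G t) at hst
      rw [hx, hy] at hst
      refine Setoid.trans' _ hsx (Setoid.trans' _ ?_ (Setoid.symm' _ hty))
      rcases hst with hst | ⟨hs, ht⟩ | ⟨hs, ht⟩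
      · exact compSetoid_left q p rfl hst
      · exact Setoid.trans' _ (compSetoid_left q p rfl (y := .inr ⟨0, h0⟩) hs)
          (Setoid.trans' _ hjoin (compSetoid_left q p rfl (x := .inr ⟨1, h1⟩) ht))
      · exact Setoid.trans' _ (compSetoid_left q p rfl (y := .inr ⟨1, h1⟩) hs)
          (Setoid.trans' _ (Setoid.symm' _ hjoin)
            (compSetoid_left q p rfl (x := .inr ⟨0, h0⟩) ht))
  rw [hcomp]
  refine hC.comp_mem _ h _ hp _ fun j => ?_
  exact hcap j.1

/-- The equivalence relation obtained from `R` by making `{a, a + 1}` a class of its own. -/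
def isolate (R : Setoid ℕ) (a : ℕ) : Setoid ℕ where
  r x y := ((x = a ∨ x = a + 1) ∧ (y = a ∨ y = a + 1)) ∨
    (¬ (x = a ∨ x = a + 1) ∧ ¬ (y = a ∨ y = a + 1) ∧ R x y)
  iseqv := by
    refine ⟨fun x => ?_, fun {x y} h => ?_, fun {x y z} h h' => ?_⟩
    · have := R.refl x
      tauto
    · have hs : R x y → R y x := fun h => R.symm h
      tauto
    · have ht : R x y → R y z → R x z := fun h h' => R.trans h h'
      tauto

/-- The increasing enumeration of the numbers other than `a` and `a + 1`. -/
def skip (a i : ℕ) : ℕ := if i < a then i else i + 2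

lemma skip_of_lt {a i : ℕ} (h : i < a) : skip a i = i := if_pos h

lemma skip_add (a i : ℕ) : skip a (a + i) = a + 2 + i := by
  rw [skip, if_neg (by omega)]
  omega

lemma skip_ne (a i : ℕ) : ¬ (skip a i = a ∨ skip a i = a + 1) := by
  unfold skip
  split_ifs <;> omega

lemma IsCategory.isolate_mem (hC : IsCategory C) {a b : ℕ} {col : ℕ → Color} {R : Setoid ℕ}
    (hcol : col (a + 1) = !(col a))
    (h : cut a b (fun i => col (skip a i)) (R.comap (skip a)) ∈ C) :
    cut a (b + 2) col (isolate R a) ∈ C := by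
  let q := cut a b (fun i => col (skip a i)) (R.comap (skip a))
  have hup : ∀ i < a, a - 1 - (0 + i) = skip a (a - 1 - i) := fun i hi => by
    rw [skip_of_lt (by omega), zero_add]
  have hlow : ∀ j, a + (2 + j) = skip a (a + j) := fun j => by
    rw [skip_add, add_assoc]
  have hlab : ∀ x : Fin q.k ⊕ Fin q.l,
      Sum.elim (fun i => a - 1 - (0 + i.1)) (fun j => a + (2 + j.1)) x = skip a (linePos q x) := by
    rintro (x | x)
    · exact hup x.1 x.2
    · exact hlow x.1
  have hten : cut a (b + 2) col (isolate R a) = tensor (pairLower (col a) (!(col a))) q := by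
    rw [cut_eq_draw]
    refine draw_eq_tensor (zero_add a).symm (add_comm b 2) (fun i => i.elim0) ?_ ?_ ?_ ?_ ?_ ?_
    · intro i
      exact congrArg (fun n => !(col n)) (hup i.1 i.2)
    · intro j
      change Fin 2 at j
      fin_cases j
      · rfl
      · exact hcol
    · intro j
      exact congrArg col (hlow j.1)
    · rintro (i | i) (j | j)
      · exact i.elim0
      · exact i.elim0
      · exact j.elim0
      · change Fin 2 at i j
        refine iff_of_true (Or.inl ?_) rfl
        change (a + i.1 = a ∨ a + i.1 = a + 1) ∧ (a + j.1 = a ∨ a + j.1 = a + 1)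
        omega
    · intro x y
      refine Iff.trans (iff_of_eq (congrArg₂ (isolate R a) (hlab x) (hlab y))) ?_
      constructor
      · rintro (h | h)
        · exact absurd h.1 (skip_ne _ _)
        · exact h.2.2
      · exact fun h => Or.inr ⟨skip_ne _ _, skip_ne _ _, h⟩
    · rintro (x | x) y hxy
      · exact x.elim0
      · have hxy : isolate R a (a + x.1) (skip a (linePos q y)) := hlab y ▸ hxy
        have hx : x.1 < 2 := x.2
        rcases hxy with h | h
        · exact skip_ne _ _ h.2
        · exact h.1 (by omega)
  rw [hten]
  exact hC.tensor_mem _ (hC.pairLower_mem rfl) _ h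

/-- The alternating coloring starting with `c`. -/
def altColor (c : Color) (n : ℕ) : Color := if n % 2 = 0 then c else !c

lemma mergeRow_zero (c : Color) (d : ℕ → Color) : mergeRow 0 c d = cut 2 2 (altColor c) ⊤ := by
  refine congr (congr (congrArg (TCP.mk 2 2) ?_) ?_) ?_
  · funext i
    fin_cases i <;> simp [capColor, altColor]
  · funext i
    fin_cases i <;> rfl
  · ext x y
    refine iff_of_true ?_ trivial
    rcases x with x | x <;> rcases y with y | y <;>
    · change x.1 - 1 = y.1 - 1
      omega

lemma fourWBWB_eq_cut : fourWBWB = cut 0 4 (altColor white) ⊤ := by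
  refine congr (congr (congrArg (TCP.mk 0 4) ?_) ?_) ?_
  · exact funext fun i => i.elim0
  · funext i
    fin_cases i <;> rfl
  · ext (x | x) (y | y)
    · exact x.elim0
    · exact x.elim0
    · exact y.elim0
    · exact iff_of_true rfl trivial

lemma IsCategory.mergeRow_mem (hC : IsCategory C) (h4 : fourWBWB ∈ C) (c : Color)
    (d : ℕ → Color) : mergeRow 0 c d ∈ C := by
  have hw : ∀ d, mergeRow 0 white d ∈ C := fun d => by
    rwa [mergeRow_zero, hC.cut_mem_iff, ← fourWBWB_eq_cut]
  cases c
  swap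
  · exact hw d
  rw [mergeRow_zero, hC.cut_mem_iff, ← hC.cut_mem_iff 1 3]
  have hpair : cut 0 2 (altColor black) ⊤ ∈ C := by
    have := hC.isolate_mem (a := 0) (b := 0) (col := altColor black) (R := ⊤) rfl
      (hC.cut_zero_mem _ _)
    rwa [cut_congr (R' := ⊤)] at this
    intro x hx y hy
    exact iff_of_true (Or.inl (by omega)) trivial
  have hpairs : cut 0 4 (altColor black) (isolate ⊤ 0) ∈ C := by
    refine hC.isolate_mem rfl ?_
    have hcol : (fun i => altColor black (skip 0 i)) = altColor black := by
      funext i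
      simp [altColor, skip]
    rwa [hcol]
  rw [show 4 = 1 + 3 from rfl, ← hC.cut_mem_iff] at hpairs
  have hglue := hC.glue_mem (a := 1) (b := 1) (hw _) rfl hpairs
  rwa [cut_congr (R' := ⊤)] at hglue
  intro x hx y hy
  refine iff_of_true ?_ trivial
  have hiso : ∀ x y, isolate ⊤ 0 x y ↔ (x ≤ 1 ↔ y ≤ 1) := fun x y => by
    change (((x = 0 ∨ x = 0 + 1) ∧ (y = 0 ∨ y = 0 + 1)) ∨
      (¬ (x = 0 ∨ x = 0 + 1) ∧ ¬ (y = 0 ∨ y = 0 + 1) ∧ True)) ↔ _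
    rw [and_true]
    omega
  rw [glue_apply, hiso, hiso, hiso, hiso, hiso]
  omega

end Category

/-! ### Every good line lies in the category -/

lemma GoodLine.color_succ {n : ℕ} {col : ℕ → Color} {R : Setoid ℕ} (h : GoodLine n col R) {x : ℕ}
    (hx : x + 1 < n) (hR : R x (x + 1)) : col (x + 1) = !(col x) := by
  have ht := h.tint_eq x (by omega) (x + 1) hx hR
  apply hue_injective
  rw [hue_not]
  have h2 : (2 : ZMod 2) = 0 := rfl
  push_cast at ht
  linear_combination (-1 : ZMod 2) * ht - h2

lemma GoodLine.skip {a b : ℕ} {col : ℕ → Color} {R : Setoid ℕ} (h : GoodLine (a + b + 2) col R)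
    (hR : R a (a + 1)) : GoodLine (a + b) (fun i => col (skip a i)) (R.comap (skip a)) where
  nc := by
    have hmono : ∀ {x y}, x < y → CTCP.skip a x < CTCP.skip a y := fun {x y} hxy => by
      unfold CTCP.skip
      split_ifs <;> omega
    intro x y z w hxy hyz hzw hw hxz hyw
    refine h.nc _ _ _ _ (hmono hxy) (hmono hyz) (hmono hzw) ?_ hxz hyw
    unfold CTCP.skip
    split_ifs <;> omega
  even := by
    intro χ hχ
    let e : Fin (a + b) → ℕ := fun i => CTCP.skip a i.1
    have hχ' : ∀ x y : Fin (a + b), R (e x) (e y) → χ x.1 = χ y.1 :=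
      fun x y hxy => hχ _ x.2 _ y.2 hxy
    let ψ := extendZero R e (fun i => χ i.1)
    have hψ : ∀ i < a + b, ψ (CTCP.skip a i) = χ i := fun i hi =>
      extendZero_apply R e (fun i => χ i.1) hχ' ⟨i, hi⟩
    have hsum := h.even ψ (fun x _ y _ hxy => extendZero_congr R e _ hχ' hxy)
    have hpair : ψ a = ψ (a + 1) := extendZero_congr R e _ hχ' hR
    rw [show a + b + 2 = a + 2 + b by omega, Finset.sum_range_add, Finset.sum_range_succ,
      Finset.sum_range_succ, add_assoc (∑ i ∈ Finset.range a, ψ i), hpair, CharTwo.add_self_eq_zero, add_zero] at hsum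
    rw [Finset.sum_range_add, ← hsum]
    congr 1
    · refine Finset.sum_congr rfl fun i hi => ?_
      have hi := Finset.mem_range.1 hi
      rw [← hψ i (by omega), skip_of_lt hi]
    · refine Finset.sum_congr rfl fun i hi => ?_
      have hi := Finset.mem_range.1 hi
      rw [← hψ (a + i) (by omega), skip_add]
  tint_eq := by
    have hcast : ∀ x, ((CTCP.skip a x : ℕ) : ZMod 2) = x := fun x => by
      have h2 : (2 : ZMod 2) = 0 := rfl
      unfold CTCP.skip
      split_ifs
      · rfl
      · push_cast
        rw [h2, add_zero]
    have hlt : ∀ x < a + b, CTCP.skip a x < a + b + 2 := fun x hx => by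
      unfold CTCP.skip
      split_ifs <;> omega
    intro x hx y hy hxy
    have := h.tint_eq _ (hlt x hx) _ (hlt y hy) hxy
    rwa [hcast, hcast] at this

open Classical in
/-- The block with the largest minimum starts with two neighbouring points and is an interval. -/
lemma GoodLine.exists_interval {n : ℕ} {col : ℕ → Color} {R : Setoid ℕ} (h : GoodLine n col R)
    (hn : 0 < n) : ∃ a, a + 1 < n ∧ R a (a + 1) ∧
      ((∀ x < n, R a x → x = a ∨ x = a + 1) ∨ (a + 2 < n ∧ R a (a + 2))) := by
  obtain ⟨a, ha, hmax⟩ := Finset.exists_max_image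
    ((Finset.range n).filter fun m => ∀ x < m, ¬ R x m) id
    ⟨0, Finset.mem_filter.2 ⟨Finset.mem_range.2 hn, fun x hx => absurd hx (Nat.not_lt_zero x)⟩⟩
  rw [Finset.mem_filter, Finset.mem_range] at ha
  obtain ⟨han, hmin⟩ := ha
  have hlater : ∀ m, a < m → m < n → ∃ x < m, R x m := by
    intro m ham hm
    by_contra hcon
    push Not at hcon
    have := hmax m (Finset.mem_filter.2 ⟨Finset.mem_range.2 hm, hcon⟩)
    exact absurd this (not_le.2 ham)
  have hfill : ∀ b < n, R a b → ∀ m, a < m → m < b → R a m := by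
    intro b hb hab m
    induction m using Nat.strong_induction_on with
    | _ m ih =>
      intro ham hmb
      obtain ⟨x, hxm, hR⟩ := hlater m ham (by omega)
      rcases lt_trichotomy x a with hxa | rfl | hxa
      · exact absurd (h.nc x a m b hxa ham hmb hb hR hab) (hmin x hxa)
      · exact hR
      · exact R.trans (ih x hxm hxa (by omega)) hR
  have hother : ∃ b < n, R a b ∧ a < b := by
    by_contra hcon
    push Not at hcon
    have hsum := h.even (fun i => if R a i then 1 else 0) (fun x _ y _ hxy => by
      have : R a x ↔ R a y := ⟨fun h => R.trans h hxy, fun h => R.trans h (R.symm hxy)⟩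
      simp only [this])
    rw [Finset.sum_eq_single a, if_pos (R.refl a)] at hsum
    · exact one_ne_zero hsum
    · intro b hb hba
      refine if_neg fun hab => ?_
      rcases lt_or_gt_of_ne hba with hlt | hlt
      · exact hmin b hlt (R.symm hab)
      · exact absurd hlt (not_lt.2 (hcon b (Finset.mem_range.1 hb) hab))
    · exact fun hcon => absurd (Finset.mem_range.2 han) hcon
  have hreach : ∀ b < n, R a b → ∀ m, a < m → m ≤ b → R a m := by
    intro b hb hab m ham hmb
    rcases hmb.lt_or_eq with hlt | rfl
    · exact hfill b hb hab m ham hlt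
    · exact hab
  obtain ⟨b, hb, hab, hlt⟩ := hother
  refine ⟨a, by omega, hreach b hb hab _ (by omega) hlt, ?_⟩
  by_cases hlong : ∃ c < n, R a c ∧ a + 1 < c
  · obtain ⟨c, hc, hac, hlt⟩ := hlong
    exact Or.inr ⟨by omega, hreach c hc hac _ (by omega) hlt⟩
  · refine Or.inl fun x hx hax => ?_
    have h1 : ¬ x < a := fun hlt => hmin x hlt (R.symm hax)
    have h2 : ¬ a + 1 < x := fun hlt => hlong ⟨x, hx, hax, hlt⟩
    omega

lemma isolate_iff_of_block {R : Setoid ℕ} {a n : ℕ} (hR : R a (a + 1))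
    (hblock : ∀ x < n, R a x → x = a ∨ x = a + 1) {x y : ℕ} (hx : x < n) (hy : y < n) :
    isolate R a x y ↔ R x y := by
  have hmem : ∀ {x}, x = a ∨ x = a + 1 → R a x := by
    rintro x (rfl | rfl)
    exacts [R.refl _, hR]
  constructor
  · rintro (⟨h, h'⟩ | ⟨-, -, h⟩)
    · exact R.trans (R.symm (hmem h)) (hmem h')
    · exact h
  · intro h
    by_cases hxa : x = a ∨ x = a + 1
    · exact Or.inl ⟨hxa, hblock y hy (R.trans (hmem hxa) h)⟩
    · refine Or.inr ⟨hxa, fun hya => hxa (hblock x hx (R.trans (hmem hya) (R.symm h))), h⟩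

lemma glue_isolate_iff {R : Setoid ℕ} {a : ℕ} (hR : R a (a + 1)) (hR' : R a (a + 2)) (x y : ℕ) :
    glue (isolate R a) (a + 1) (a + 2) x y ↔ R x y := by
  have hmem : ∀ {x}, x = a ∨ x = a + 1 → R x (a + 2) := by
    rintro x (rfl | rfl)
    exacts [hR', R.trans (R.symm hR) hR']
  have hle : ∀ {x y}, isolate R a x y → R x y := by
    rintro x y (⟨h, h'⟩ | ⟨-, -, h⟩)
    · exact R.trans (hmem h) (R.symm (hmem h'))
    · exact h
  constructor
  · rintro (h | ⟨h, h'⟩ | ⟨h, h'⟩)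
    · exact hle h
    · exact R.trans (hle h) (R.trans (hmem (Or.inr rfl)) (hle h'))
    · exact R.trans (hle h) (R.trans (R.symm (hmem (Or.inr rfl))) (hle h'))
  · intro h
    by_cases hx : x = a ∨ x = a + 1 <;> by_cases hy : y = a ∨ y = a + 1
    · exact Or.inl (Or.inl ⟨hx, hy⟩)
    · refine Or.inr (Or.inl ⟨Or.inl ⟨hx, Or.inr rfl⟩, Or.inr ⟨by omega, hy, ?_⟩⟩)
      exact R.trans (R.symm (hmem hx)) h
    · refine Or.inr (Or.inr ⟨Or.inr ⟨hx, by omega, ?_⟩, Or.inl ⟨Or.inr rfl, hy⟩⟩)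
      exact R.trans h (hmem hy)
    · exact Or.inl (Or.inr ⟨hx, hy, h⟩)

lemma GoodLine.cut_mem {C : Set TCP} (hC : IsCategory C) (h4 : fourWBWB ∈ C) {n : ℕ}
    {col : ℕ → Color} {R : Setoid ℕ} (h : GoodLine n col R) : cut 0 n col R ∈ C := by
  induction n using Nat.strong_induction_on generalizing col R with
  | _ n ih =>
    rcases Nat.eq_zero_or_pos n with rfl | hn
    · exact hC.cut_zero_mem _ _
    obtain ⟨a, han, hR, hblock⟩ := h.exists_interval hn
    obtain ⟨b, rfl⟩ : ∃ b, n = a + b + 2 := ⟨n - a - 2, by omega⟩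
    have hsmall := ih (a + b) (by omega) (h.skip hR)
    rw [← hC.cut_mem_iff] at hsmall
    have hiso := hC.isolate_mem (h.color_succ han hR) hsmall
    rw [add_assoc, ← hC.cut_mem_iff]
    rcases hblock with hblock | ⟨hlt, hR'⟩
    · rwa [cut_congr (R' := R)] at hiso
      exact fun x hx y hy => isolate_iff_of_block hR hblock hx hy
    · obtain ⟨m, rfl⟩ : ∃ m, b = m + 1 := ⟨b - 1, by omega⟩
      have hglue := hC.glue_mem (a := a + 1) (b := m) (hC.mergeRow_mem h4 _ _)
        (h.color_succ hlt (R.trans (R.symm hR) hR')) (hC.cut_up hiso)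
      rw [cut_congr (R' := R) fun x _ y _ => glue_isolate_iff hR hR' x y] at hglue
      exact hC.cut_down hglue

/-- `⟨∘•∘•⟩` consists of the noncrossing partitions all of whose blocks have even length
with alternating colors, when rotated to a partition with no upper points. -/
theorem stmt_13 :
    generated {fourWBWB} =
      {p : TCP | Noncrossing p ∧
        (∀ x : Fin (toLine p).k ⊕ Fin (toLine p).l, Even (blockSize (toLine p) x)) ∧
        ∀ j j' : Fin (toLine p).l, (toLine p).rel.r (Sum.inr j) (Sum.inr j') → j.1 < j'.1 →
          (∀ m : Fin (toLine p).l, (toLine p).rel.r (Sum.inr j) (Sum.inr m) →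
            ¬(j.1 < m.1 ∧ m.1 < j'.1)) →
          (toLine p).lowColor j' = !((toLine p).lowColor j)} := by
  ext p
  change p ∈ generated {fourWBWB} ↔ Noncrossing p ∧ EvenAlternating (toLine p)
  rw [eq_cut p, toLine_cut, noncrossing_cut]
  constructor
  · intro hp
    have hgood : GoodLine (p.k + p.l) (lineCol p) (lineRel p) :=
      Good.goodLine (hp _ isCategory_good (Set.singleton_subset_iff.2 good_fourWBWB))
    exact ⟨hgood.nc, hgood.evenAlternating⟩
  · rintro ⟨nc, h⟩ C hC h4
    rw [hC.cut_mem_iff]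
    exact (goodLine_of_evenAlternating nc h).cut_mem hC (h4 rfl)

end CTCP
end
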